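/- arXiv:2312.04844 — 3 statements merged into one kernel-verified Lean document; each statement's English description precedes it below -/
import Mathlib

section
/- The S-algebra homomorphism ι₁ : bH_n(q) → E_n(q) determined by ι₁(e_i) = e_i and ι₁(z_i) = e_i g_i for all i ∈ {1,…,n−1} is injective; that is, bH_n(q) embeds into E_n(q). -/
open scoped Classical

noncomputable section

/-- The ground ring `S = ℂ[q, q⁻¹]` of Laurent polynomials. -/
abbrev SS : Type := LaurentPolynomial ℂ

/-- The indeterminate `q ∈ S`. -/
def qq : SS := LaurentPolynomial.T 1

/-- The inverse `q⁻¹ ∈ S` of the indeterminate. -/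
def qqi : SS := LaurentPolynomial.T (-1)

/-- Generators `e_1,…,e_{n−1}, z_1,…,z_{n−1}` of the tied–boxed Hecke algebra. -/
inductive BHGen (n : ℕ) : Type
  | e : Fin (n - 1) → BHGen n
  | z : Fin (n - 1) → BHGen n

/-- The defining relations of the tied–boxed Hecke algebra `bH_n(q)`:
`e_i² = e_i`, `e_i e_j = e_j e_i`, the braid relations for the `z_i`,
`z_i z_j = z_j z_i` for `|i−j| > 1`, `e_i z_i = z_i`, `e_i z_j = z_j e_i`, and
`z_i² = e_i + (q − q⁻¹) z_i`. -/
inductive BHRel (n : ℕ) : FreeAlgebra SS (BHGen n) → FreeAlgebra SS (BHGen n) → Prop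
  | esq (i : Fin (n - 1)) :
      BHRel n (FreeAlgebra.ι SS (BHGen.e i) * FreeAlgebra.ι SS (BHGen.e i))
        (FreeAlgebra.ι SS (BHGen.e i))
  | ecomm (i j : Fin (n - 1)) :
      BHRel n (FreeAlgebra.ι SS (BHGen.e i) * FreeAlgebra.ι SS (BHGen.e j))
        (FreeAlgebra.ι SS (BHGen.e j) * FreeAlgebra.ι SS (BHGen.e i))
  | braid (i j : Fin (n - 1)) (h : Nat.dist i.1 j.1 = 1) :
      BHRel n
        (FreeAlgebra.ι SS (BHGen.z i) * FreeAlgebra.ι SS (BHGen.z j) *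
          FreeAlgebra.ι SS (BHGen.z i))
        (FreeAlgebra.ι SS (BHGen.z j) * FreeAlgebra.ι SS (BHGen.z i) *
          FreeAlgebra.ι SS (BHGen.z j))
  | zcomm (i j : Fin (n - 1)) (h : 1 < Nat.dist i.1 j.1) :
      BHRel n (FreeAlgebra.ι SS (BHGen.z i) * FreeAlgebra.ι SS (BHGen.z j))
        (FreeAlgebra.ι SS (BHGen.z j) * FreeAlgebra.ι SS (BHGen.z i))
  | ez (i : Fin (n - 1)) :
      BHRel n (FreeAlgebra.ι SS (BHGen.e i) * FreeAlgebra.ι SS (BHGen.z i))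
        (FreeAlgebra.ι SS (BHGen.z i))
  | ezcomm (i j : Fin (n - 1)) :
      BHRel n (FreeAlgebra.ι SS (BHGen.e i) * FreeAlgebra.ι SS (BHGen.z j))
        (FreeAlgebra.ι SS (BHGen.z j) * FreeAlgebra.ι SS (BHGen.e i))
  | quad (i : Fin (n - 1)) :
      BHRel n (FreeAlgebra.ι SS (BHGen.z i) * FreeAlgebra.ι SS (BHGen.z i))
        (FreeAlgebra.ι SS (BHGen.e i) + (qq - qqi) • FreeAlgebra.ι SS (BHGen.z i))

/-- The tied–boxed Hecke algebra `bH_n(q)`, as the quotient of the free `S`-algebra on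
the generators by the two-sided ideal generated by the defining relations. -/
abbrev BH (n : ℕ) : Type := RingQuot (BHRel n)

/-- The generator `e_i` of `bH_n(q)`. -/
def bhE {n : ℕ} (i : Fin (n - 1)) : BH n :=
  RingQuot.mkAlgHom SS (BHRel n) (FreeAlgebra.ι SS (BHGen.e i))

/-- The generator `z_i` of `bH_n(q)`. -/
def bhZ {n : ℕ} (i : Fin (n - 1)) : BH n :=
  RingQuot.mkAlgHom SS (BHRel n) (FreeAlgebra.ι SS (BHGen.z i))

/-- Generators `e_1,…,e_{n−1}, g_1,…,g_{n−1}` of the algebra of braids and ties. -/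
inductive BTGen (n : ℕ) : Type
  | e : Fin (n - 1) → BTGen n
  | g : Fin (n - 1) → BTGen n

/-- The defining relations of the algebra of braids and ties `E_n(q)`. -/
inductive BTRel (n : ℕ) : FreeAlgebra SS (BTGen n) → FreeAlgebra SS (BTGen n) → Prop
  | esq (i : Fin (n - 1)) :
      BTRel n (FreeAlgebra.ι SS (BTGen.e i) * FreeAlgebra.ι SS (BTGen.e i))
        (FreeAlgebra.ι SS (BTGen.e i))
  | ecomm (i j : Fin (n - 1)) :
      BTRel n (FreeAlgebra.ι SS (BTGen.e i) * FreeAlgebra.ι SS (BTGen.e j))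
        (FreeAlgebra.ι SS (BTGen.e j) * FreeAlgebra.ι SS (BTGen.e i))
  | braid (i j : Fin (n - 1)) (h : Nat.dist i.1 j.1 = 1) :
      BTRel n
        (FreeAlgebra.ι SS (BTGen.g i) * FreeAlgebra.ι SS (BTGen.g j) *
          FreeAlgebra.ι SS (BTGen.g i))
        (FreeAlgebra.ι SS (BTGen.g j) * FreeAlgebra.ι SS (BTGen.g i) *
          FreeAlgebra.ι SS (BTGen.g j))
  | gcomm (i j : Fin (n - 1)) (h : 1 < Nat.dist i.1 j.1) :
      BTRel n (FreeAlgebra.ι SS (BTGen.g i) * FreeAlgebra.ι SS (BTGen.g j))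
        (FreeAlgebra.ι SS (BTGen.g j) * FreeAlgebra.ι SS (BTGen.g i))
  | ge (i : Fin (n - 1)) :
      BTRel n (FreeAlgebra.ι SS (BTGen.g i) * FreeAlgebra.ι SS (BTGen.e i))
        (FreeAlgebra.ι SS (BTGen.e i) * FreeAlgebra.ι SS (BTGen.g i))
  | gecomm (i j : Fin (n - 1)) (h : 1 < Nat.dist i.1 j.1) :
      BTRel n (FreeAlgebra.ι SS (BTGen.g i) * FreeAlgebra.ι SS (BTGen.e j))
        (FreeAlgebra.ι SS (BTGen.e j) * FreeAlgebra.ι SS (BTGen.g i))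
  | egg (i j : Fin (n - 1)) (h : Nat.dist i.1 j.1 = 1) :
      BTRel n
        (FreeAlgebra.ι SS (BTGen.e i) * FreeAlgebra.ι SS (BTGen.g j) *
          FreeAlgebra.ι SS (BTGen.g i))
        (FreeAlgebra.ι SS (BTGen.g j) * FreeAlgebra.ι SS (BTGen.g i) *
          FreeAlgebra.ι SS (BTGen.e j))
  | eeg (i j : Fin (n - 1)) (h : Nat.dist i.1 j.1 = 1) :
      BTRel n
        (FreeAlgebra.ι SS (BTGen.e i) * FreeAlgebra.ι SS (BTGen.e j) *
          FreeAlgebra.ι SS (BTGen.g j))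
        (FreeAlgebra.ι SS (BTGen.e i) * FreeAlgebra.ι SS (BTGen.g j) *
          FreeAlgebra.ι SS (BTGen.e i))
  | ege (i j : Fin (n - 1)) (h : Nat.dist i.1 j.1 = 1) :
      BTRel n
        (FreeAlgebra.ι SS (BTGen.e i) * FreeAlgebra.ι SS (BTGen.g j) *
          FreeAlgebra.ι SS (BTGen.e i))
        (FreeAlgebra.ι SS (BTGen.g j) * FreeAlgebra.ι SS (BTGen.e i) *
          FreeAlgebra.ι SS (BTGen.e j))
  | quad (i : Fin (n - 1)) :
      BTRel n (FreeAlgebra.ι SS (BTGen.g i) * FreeAlgebra.ι SS (BTGen.g i))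
        (1 + (qq - qqi) • (FreeAlgebra.ι SS (BTGen.e i) * FreeAlgebra.ι SS (BTGen.g i)))

/-- The algebra of braids and ties `E_n(q)`, as the quotient of the free `S`-algebra on
the generators by the two-sided ideal generated by the defining relations. -/
abbrev BT (n : ℕ) : Type := RingQuot (BTRel n)

/-- The generator `e_i` of `E_n(q)`. -/
def btE {n : ℕ} (i : Fin (n - 1)) : BT n :=
  RingQuot.mkAlgHom SS (BTRel n) (FreeAlgebra.ι SS (BTGen.e i))

/-- The generator `g_i` of `E_n(q)`. -/
def btG {n : ℕ} (i : Fin (n - 1)) : BT n :=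
  RingQuot.mkAlgHom SS (BTRel n) (FreeAlgebra.ι SS (BTGen.g i))

end


noncomputable section

/-- Permutations of `ℕ` increasing on each colour class of `c`. -/
def XX (c : ℕ → ℕ) : Type :=
  {σ : Equiv.Perm ℕ // ∀ a b, a < b → c (σ a) = c (σ b) → σ a < σ b}

/-- Value of the permutation. -/
def pv {c : ℕ → ℕ} (σ : XX c) (k : ℕ) : ℕ := σ.1 k

theorem XX_ext {c : ℕ → ℕ} {σ τ : XX c} (h : ∀ k, pv σ k = pv τ k) : σ = τ :=
  Subtype.ext (Equiv.ext h)

/-- The transposition of `i` and `i+1`. -/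
def sw (i k : ℕ) : ℕ := if k = i then i + 1 else if k = i + 1 then i else k

theorem swap_sw (i k : ℕ) : Equiv.swap i (i+1) k = sw i k := by
  simp [Equiv.swap_apply_def, sw]

/-- The partial action of a simple transposition. -/
def step {c : ℕ → ℕ} (i : ℕ) (σ : XX c) : XX c :=
  if h : c (pv σ i) = c (pv σ (i+1)) then σ else
    ⟨σ.1 * Equiv.swap i (i+1), by
      intro a b hab hc
      simp only [Equiv.Perm.mul_apply, swap_sw] at hc ⊢
      by_cases hlt : sw i a < sw i b
      · exact σ.2 _ _ hlt hc
      · exfalso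
        have : a = i ∧ b = i + 1 := by
          unfold sw at hlt
          split_ifs at hlt <;> omega
        obtain ⟨rfl, rfl⟩ := this
        apply h
        simp [sw] at hc
        exact hc.symm⟩

theorem step_same {c : ℕ → ℕ} {i : ℕ} {σ : XX c} (h : c (pv σ i) = c (pv σ (i+1))) :
    step i σ = σ := by
  simp [step, h]

theorem step_pv {c : ℕ → ℕ} {i : ℕ} {σ : XX c} (h : ¬ c (pv σ i) = c (pv σ (i+1))) (k : ℕ) :
    pv (step i σ) k = pv σ (sw i k) := by
  have : step i σ = ⟨σ.1 * Equiv.swap i (i+1), _⟩ := dif_neg h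
  rw [this]
  simp only [pv, Equiv.Perm.mul_apply, swap_sw]

theorem step_col {c : ℕ → ℕ} (i : ℕ) (σ : XX c) (k : ℕ) :
    c (pv (step i σ) k) = c (pv σ (sw i k)) := by
  by_cases h : c (pv σ i) = c (pv σ (i+1))
  · rw [step_same h]
    unfold sw
    split_ifs with h1 h2
    · rw [h1, h]
    · rw [h2, h]
    · rfl
  · rw [step_pv h]

theorem pv_succ {c : ℕ → ℕ} (hc : Monotone c) {σ : XX c} {i : ℕ}
    (h : c (pv σ i) = c (pv σ (i+1))) : pv σ (i+1) = pv σ i + 1 := by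
  have h1 : pv σ i < pv σ (i+1) := σ.2 i (i+1) (by omega) h
  by_contra hne
  have hcm : c (pv σ i + 1) = c (pv σ i) :=
    le_antisymm (by rw [h]; exact hc (by omega)) (hc (by omega))
  obtain ⟨k, hk⟩ := σ.1.surjective (pv σ i + 1)
  change pv σ k = _ at hk
  rcases lt_trichotomy k i with hlt | heq | hgt
  · have := σ.2 k i hlt (by change c (pv σ k) = c (pv σ i); rw [hk, hcm])
    change pv σ k < pv σ i at this
    omega
  · subst heq; omega
  · by_cases hki : k = i + 1
    · subst hki; omega
    · have := σ.2 (i+1) k (by omega) (by change c (pv σ (i+1)) = c (pv σ k); rw [hk, hcm, h])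
      change pv σ (i+1) < pv σ k at this
      omega

theorem pv_inj {c : ℕ → ℕ} {σ : XX c} {i j : ℕ} (h : pv σ i = pv σ j) : i = j :=
  σ.1.injective h

theorem sw_braid (i k : ℕ) :
    sw i (sw (i+1) (sw i k)) = sw (i+1) (sw i (sw (i+1) k)) := by
  unfold sw; split_ifs <;> omega

theorem sw_comm (i j k : ℕ) (h : i + 1 < j) : sw i (sw j k) = sw j (sw i k) := by
  unfold sw; split_ifs <;> omega

theorem sw_sw (i k : ℕ) : sw i (sw i k) = k := by
  unfold sw; split_ifs <;> omega

@[simp] theorem sw_a (i : ℕ) : sw i i = i + 1 := by simp [sw]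
@[simp] theorem sw_b (i : ℕ) : sw i (i+1) = i := by simp [sw]
@[simp] theorem sw_c (i : ℕ) : sw i (i+1+1) = i+1+1 := by unfold sw; split_ifs <;> omega
@[simp] theorem sw_d (i : ℕ) : sw (i+1) i = i := by unfold sw; split_ifs <;> omega

theorem step_step {c : ℕ → ℕ} (i : ℕ) (σ : XX c) : step i (step i σ) = σ := by
  by_cases h : c (pv σ i) = c (pv σ (i+1))
  · rw [step_same h, step_same h]
  · apply XX_ext
    intro k
    rw [step_pv (by simpa [step_col] using fun h' => h h'.symm), step_pv h, sw_sw]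

theorem step_comm {c : ℕ → ℕ} (i j : ℕ) (hij : i + 1 < j) (σ : XX c) :
    step i (step j σ) = step j (step i σ) := by
  have e1 : sw i j = j := by unfold sw; split_ifs <;> omega
  have e2 : sw i (j+1) = j+1 := by unfold sw; split_ifs <;> omega
  have e3 : sw j i = i := by unfold sw; split_ifs <;> omega
  have e4 : sw j (i+1) = i+1 := by unfold sw; split_ifs <;> omega
  by_cases h : c (pv σ i) = c (pv σ (i+1))
  · rw [step_same h, step_same (by simpa [step_col, e3, e4] using h)]
  · by_cases h' : c (pv σ j) = c (pv σ (j+1))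
    · rw [step_same h', step_same (i := j) (by simpa [step_col, e1, e2] using h')]
    · apply XX_ext
      intro k
      rw [step_pv (by simpa [step_col, e3, e4] using h), step_pv h',
        step_pv (by simpa [step_col, e1, e2] using h'), step_pv h, sw_comm i j k hij]

theorem step_braid {c : ℕ → ℕ} (i : ℕ) (σ : XX c) :
    step i (step (i+1) (step i σ)) = step (i+1) (step i (step (i+1) σ)) := by
  by_cases h : c (pv σ i) = c (pv σ (i+1))
  · rw [step_same h]
    rw [step_same (i := i+1) (σ := step i _) (by simpa [step_col] using h)]
  · by_cases h' : c (pv σ (i+1)) = c (pv σ (i+1+1))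
    · rw [step_same (i := i+1) (σ := σ) h']
      rw [step_same (i := i) (σ := step (i+1) _) (by simpa [step_col] using h')]
    · by_cases h'' : c (pv σ i) = c (pv σ (i+1+1))
      · rw [step_same (i := i+1) (σ := step i σ) (by simpa [step_col] using h''), step_step]
        rw [step_same (i := i) (σ := step (i+1) σ) (by simpa [step_col] using h''), step_step]
      · apply XX_ext
        intro k
        rw [step_pv (by simpa [step_col] using h'), step_pv (by simpa [step_col] using h''),
          step_pv h, step_pv (by simpa [step_col] using h), step_pv (by simpa [step_col] using h''),
          step_pv h', sw_braid]

section ops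
variable {A : Type} [Ring A] [Algebra SS A] (c : ℕ → ℕ) (T : ℕ → A)

/-- The coefficient. -/
def tt (i : ℕ) (σ : XX c) : A := if c (pv σ i) = c (pv σ (i+1)) then T (pv σ i) else 1

/-- The operator of `g_i`. -/
def gOp (i : ℕ) : Module.End SS (XX c → A) where
  toFun φ := fun σ => tt c T i σ * φ (step i σ)
  map_add' φ ψ := by ext σ; simp [mul_add]
  map_smul' r φ := by ext σ; simp

/-- The operator of `e_i`. -/
def eOp (i : ℕ) : Module.End SS (XX c → A) where
  toFun φ := fun σ => if c (pv σ i) = c (pv σ (i+1)) then φ σ else 0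
  map_add' φ ψ := by ext σ; simp only [Pi.add_apply]; split_ifs <;> simp
  map_smul' r φ := by ext σ; simp

theorem gOp_apply (i : ℕ) (φ : XX c → A) (σ : XX c) :
    gOp c T i φ σ = tt c T i σ * φ (step i σ) := rfl

theorem eOp_apply (i : ℕ) (φ : XX c → A) (σ : XX c) :
    eOp c i φ σ = if c (pv σ i) = c (pv σ (i+1)) then φ σ else 0 := rfl

theorem op_esq (i : ℕ) : eOp (A := A) c i * eOp c i = eOp c i := by
  apply LinearMap.ext; intro φ; funext σ
  simp only [Module.End.mul_apply, eOp_apply]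
  split_ifs <;> rfl

theorem op_ecomm (i j : ℕ) : eOp (A := A) c i * eOp c j = eOp c j * eOp c i := by
  apply LinearMap.ext; intro φ; funext σ
  simp only [Module.End.mul_apply, eOp_apply]
  split_ifs <;> rfl

theorem op_ge (i : ℕ) : gOp c T i * eOp c i = eOp c i * gOp c T i := by
  apply LinearMap.ext; intro φ; funext σ
  simp only [Module.End.mul_apply, eOp_apply, gOp_apply, step_col, sw_a, sw_b]
  by_cases h : c (pv σ i) = c (pv σ (i+1))
  · simp [h]
  · simp [h, Ne.symm h]

theorem op_gecomm (i j : ℕ) (h : 1 < Nat.dist i j) :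
    gOp c T i * eOp c j = eOp c j * gOp c T i := by
  have hh : i + 1 < j ∨ j + 1 < i := by unfold Nat.dist at h; omega
  have e1 : sw i j = j := by unfold sw; split_ifs <;> omega
  have e2 : sw i (j+1) = j+1 := by unfold sw; split_ifs <;> omega
  apply LinearMap.ext; intro φ; funext σ
  simp only [Module.End.mul_apply, eOp_apply, gOp_apply, step_col, e1, e2]
  split_ifs <;> simp

theorem tt_far (i j : ℕ) (h : i + 1 < j ∨ j + 1 < i) (σ : XX c) :
    tt c T j (step i σ) = tt c T j σ := by
  have e1 : sw i j = j := by unfold sw; split_ifs <;> omega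
  have e2 : sw i (j+1) = j+1 := by unfold sw; split_ifs <;> omega
  unfold tt
  rw [step_col (c := c), step_col (c := c), e1, e2]
  by_cases hs : c (pv σ i) = c (pv σ (i+1))
  · rw [step_same hs]
  · rw [step_pv hs, e1]

variable (hc : Monotone c)
  (hcomm : ∀ k l, c k = c (k+1) → c l = c (l+1) → k + 1 < l → T k * T l = T l * T k)
  (hbraid : ∀ k, c k = c (k+1) → c (k+1) = c (k+1+1) →
    T k * T (k+1) * T k = T (k+1) * T k * T (k+1))
  (hquad : ∀ k, c k = c (k+1) → T k * T k = 1 + (qq - qqi) • T k)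

include hc hcomm in
theorem op_gcomm' (i j : ℕ) (h : i + 1 < j) :
    gOp c T i * gOp c T j = gOp c T j * gOp c T i := by
  apply LinearMap.ext; intro φ; funext σ
  simp only [Module.End.mul_apply, gOp_apply]
  rw [tt_far c T i j (Or.inl h), tt_far c T j i (Or.inr h), step_comm i j h, ← mul_assoc,
    ← mul_assoc]
  congr 1
  unfold tt
  split_ifs with h1 h2 h2
  · have p1 := pv_succ hc h1
    have p2 := pv_succ hc h2
    have n1 : pv σ i ≠ pv σ j := fun e => by have := pv_inj e; omega
    have n2 : pv σ (i+1) ≠ pv σ j := fun e => by have := pv_inj e; omega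
    have n3 : pv σ i ≠ pv σ (j+1) := fun e => by have := pv_inj e; omega
    rw [p1] at h1 n2
    rw [p2] at h2 n3
    rcases lt_or_ge (pv σ i + 1) (pv σ j) with hl | hl
    · exact hcomm _ _ h1 h2 hl
    · exact (hcomm _ _ h2 h1 (by omega)).symm
  all_goals simp

include hc hcomm in
theorem op_gcomm (i j : ℕ) (h : 1 < Nat.dist i j) :
    gOp c T i * gOp c T j = gOp c T j * gOp c T i := by
  have hh : i + 1 < j ∨ j + 1 < i := by unfold Nat.dist at h; omega
  rcases hh with hh | hh
  · exact op_gcomm' c T hc hcomm i j hh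
  · exact (op_gcomm' c T hc hcomm j i hh).symm

include hquad hc in
theorem op_quad (i : ℕ) :
    gOp c T i * gOp c T i = 1 + (qq - qqi) • (eOp c i * gOp c T i) := by
  apply LinearMap.ext; intro φ; funext σ
  simp only [Module.End.mul_apply, gOp_apply, LinearMap.add_apply, LinearMap.smul_apply,
    Pi.add_apply, Pi.smul_apply, eOp_apply, Module.End.one_apply, step_step]
  by_cases h : c (pv σ i) = c (pv σ (i+1))
  · have h' := h
    rw [pv_succ hc h] at h'
    rw [step_same h, if_pos h]
    simp only [tt, if_pos h]
    rw [← mul_assoc, hquad _ h', add_mul, one_mul, smul_mul_assoc]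
  · have : ¬ c (pv (step i σ) i) = c (pv (step i σ) (i+1)) := by
      simpa [step_col] using fun h' => h h'.symm
    simp [tt, h, this]

include hc hbraid in
theorem op_braid (i : ℕ) :
    gOp c T i * gOp c T (i+1) * gOp c T i = gOp c T (i+1) * gOp c T i * gOp c T (i+1) := by
  apply LinearMap.ext; intro φ; funext σ
  simp only [Module.End.mul_apply, gOp_apply]
  rw [step_braid]
  simp only [← mul_assoc]
  congr 1
  simp only [tt, step_col, sw_a, sw_b, sw_c, sw_d]
  by_cases h : c (pv σ i) = c (pv σ (i+1))
  · by_cases h' : c (pv σ (i+1)) = c (pv σ (i+1+1))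
    · rw [step_same h, step_same h', step_same h]
      have p1 := pv_succ hc h
      have p2 := pv_succ hc h'
      simp only [h, h', if_true]
      rw [p1]
      rw [p1] at h h' p2
      rw [p2] at h'
      exact hbraid _ h h'
    · have hs : ¬ c (pv (step (i+1) σ) i) = c (pv (step (i+1) σ) (i+1)) := by
        simpa [step_col, h] using h'
      simp [h, h', step_pv hs, step_pv h']
  · by_cases h' : c (pv σ (i+1)) = c (pv σ (i+1+1))
    · have hs : ¬ c (pv (step i σ) (i+1)) = c (pv (step i σ) (i+1+1)) := by
        simpa [step_col, ← h'] using h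
      have h2 : ¬ c (pv σ i) = c (pv σ (i+1+1)) := by rwa [← h']
      simp [h, h', h2, step_pv hs, step_pv h]
    · by_cases h2 : c (pv σ i) = c (pv σ (i+1+1))
      · have h3 : ¬ c (pv σ (i+1+1)) = c (pv σ (i+1)) := fun e => h' e.symm
        simp [h, h', h2, h3, step_pv h, step_pv h']
      · simp [h, h', h2]

theorem op_egg1 (i : ℕ) :
    eOp c i * gOp c T (i+1) * gOp c T i = gOp c T (i+1) * gOp c T i * eOp c (i+1) := by
  apply LinearMap.ext; intro φ; funext σ
  simp only [Module.End.mul_apply, gOp_apply, eOp_apply, step_col, sw_a, sw_b, sw_c, sw_d]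
  split_ifs <;> simp

theorem op_egg2 (i : ℕ) :
    eOp c (i+1) * gOp c T i * gOp c T (i+1) = gOp c T i * gOp c T (i+1) * eOp c i := by
  apply LinearMap.ext; intro φ; funext σ
  simp only [Module.End.mul_apply, gOp_apply, eOp_apply, step_col, sw_a, sw_b, sw_c, sw_d]
  split_ifs <;> simp

theorem op_eeg (i j : ℕ) (hij : j = i + 1 ∨ i = j + 1) :
    eOp c i * eOp c j * gOp c T j = eOp c i * gOp c T j * eOp c i := by
  apply LinearMap.ext; intro φ; funext σ
  rcases hij with rfl | rfl <;>
  simp only [Module.End.mul_apply, gOp_apply, eOp_apply, step_col, sw_a, sw_b, sw_c, sw_d] <;>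
  split_ifs <;> first | (exfalso; omega) | simp

theorem op_ege (i j : ℕ) (hij : j = i + 1 ∨ i = j + 1) :
    eOp c i * gOp c T j * eOp c i = gOp c T j * eOp c i * eOp c j := by
  apply LinearMap.ext; intro φ; funext σ
  rcases hij with rfl | rfl <;>
  simp only [Module.End.mul_apply, gOp_apply, eOp_apply, step_col, sw_a, sw_b, sw_c, sw_d] <;>
  split_ifs <;> first | (exfalso; omega) | simp

/-- Images of the generators of `E_n(q)`. -/
def rhoGen (n : ℕ) : BTGen n → Module.End SS (XX c → A)
  | BTGen.e i => eOp c i.1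
  | BTGen.g i => gOp c T i.1

theorem natdist_one {i j : ℕ} (h : Nat.dist i j = 1) : j = i + 1 ∨ i = j + 1 := by
  unfold Nat.dist at h; omega

include hc hcomm hbraid hquad in
theorem rho_exists (n : ℕ) : ∃ ρ : BT n →ₐ[SS] Module.End SS (XX c → A),
    (∀ i, ρ (btE i) = eOp c i.1) ∧ (∀ i, ρ (btG i) = gOp c T i.1) := by
  have key : ∀ ⦃x y : FreeAlgebra SS (BTGen n)⦄, BTRel n x y →
      FreeAlgebra.lift SS (rhoGen c T n) x = FreeAlgebra.lift SS (rhoGen c T n) y := by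
    intro x y h
    cases h with
    | esq i => simpa [rhoGen] using op_esq c i.1
    | ecomm i j => simpa [rhoGen] using op_ecomm c i.1 j.1
    | braid i j h =>
      simp only [map_mul, FreeAlgebra.lift_ι_apply, rhoGen]
      rcases natdist_one h with h | h <;> rw [h]
      · exact op_braid c T hc hbraid _
      · exact (op_braid c T hc hbraid _).symm
    | gcomm i j h => simpa [rhoGen] using op_gcomm c T hc hcomm _ _ h
    | ge i => simpa [rhoGen] using op_ge c T _
    | gecomm i j h => simpa [rhoGen] using op_gecomm c T _ _ h
    | egg i j h =>
      simp only [map_mul, FreeAlgebra.lift_ι_apply, rhoGen]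
      rcases natdist_one h with h | h <;> rw [h]
      · exact op_egg1 c T _
      · exact op_egg2 c T _
    | eeg i j h => simpa [rhoGen] using op_eeg c T _ _ (natdist_one h)
    | ege i j h => simpa [rhoGen] using op_ege c T _ _ (natdist_one h)
    | quad i =>
      simp only [map_mul, map_add, map_one, map_smul, FreeAlgebra.lift_ι_apply, rhoGen]
      exact op_quad c T hc hquad _
  refine ⟨RingQuot.liftAlgHom SS ⟨FreeAlgebra.lift SS (rhoGen c T n), key⟩, ?_, ?_⟩
  · intro i
    simp [btE, rhoGen]
  · intro i
    simp [btG, rhoGen]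

end ops

section bh
variable {n : ℕ}

theorem bh_esq (i : Fin (n-1)) : bhE i * bhE i = bhE i := by
  simpa [bhE] using RingQuot.mkAlgHom_rel SS (BHRel.esq i)

theorem bh_ecomm (i j : Fin (n-1)) : bhE i * bhE j = bhE j * bhE i := by
  simpa [bhE] using RingQuot.mkAlgHom_rel SS (BHRel.ecomm i j)

theorem bh_braid (i j : Fin (n-1)) (h : Nat.dist i.1 j.1 = 1) :
    bhZ i * bhZ j * bhZ i = bhZ j * bhZ i * bhZ j := by
  simpa [bhZ] using RingQuot.mkAlgHom_rel SS (BHRel.braid i j h)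

theorem bh_zcomm (i j : Fin (n-1)) (h : 1 < Nat.dist i.1 j.1) :
    bhZ i * bhZ j = bhZ j * bhZ i := by
  simpa [bhZ] using RingQuot.mkAlgHom_rel SS (BHRel.zcomm i j h)

theorem bh_ez (i : Fin (n-1)) : bhE i * bhZ i = bhZ i := by
  simpa [bhE, bhZ] using RingQuot.mkAlgHom_rel SS (BHRel.ez i)

theorem bh_ezcomm (i j : Fin (n-1)) : bhE i * bhZ j = bhZ j * bhE i := by
  simpa [bhE, bhZ] using RingQuot.mkAlgHom_rel SS (BHRel.ezcomm i j)

theorem bh_quad (i : Fin (n-1)) : bhZ i * bhZ i = bhE i + (qq - qqi) • bhZ i := by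
  have := RingQuot.mkAlgHom_rel SS (BHRel.quad i)
  rw [map_mul, map_add, map_smul] at this
  exact this

theorem bh_induction {P : BH n → Prop} (halg : ∀ r : SS, P (algebraMap SS (BH n) r))
    (hE : ∀ i, P (bhE i)) (hZ : ∀ i, P (bhZ i)) (hmul : ∀ x y, P x → P y → P (x * y))
    (hadd : ∀ x y, P x → P y → P (x + y)) (x : BH n) : P x := by
  obtain ⟨y, rfl⟩ := RingQuot.mkAlgHom_surjective SS (BHRel n) x
  induction y using FreeAlgebra.induction with
  | grade0 r => rw [AlgHom.commutes]; exact halg r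
  | grade1 g =>
    cases g with
    | e i => exact hE i
    | z i => exact hZ i
  | mul a b ha hb => rw [map_mul]; exact hmul _ _ ha hb
  | add a b ha hb => rw [map_add]; exact hadd _ _ ha hb

/-- An algebra generated by elements satisfying the relations of `bH_n(q)`. -/
structure IsBH (n : ℕ) {B : Type} [Ring B] [Algebra SS B] (e z : Fin (n-1) → B) : Prop where
  esq : ∀ i, e i * e i = e i
  ecomm : ∀ i j, e i * e j = e j * e i
  braid : ∀ i j : Fin (n-1), Nat.dist i.1 j.1 = 1 → z i * z j * z i = z j * z i * z j
  zcomm : ∀ i j : Fin (n-1), 1 < Nat.dist i.1 j.1 → z i * z j = z j * z i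
  ez : ∀ i, e i * z i = z i
  ezcomm : ∀ i j, e i * z j = z j * e i
  quad : ∀ i, z i * z i = e i + (qq - qqi) • z i
  ind : ∀ P : B → Prop, (∀ r : SS, P (algebraMap SS B r)) → (∀ i, P (e i)) → (∀ i, P (z i)) →
    (∀ x y, P x → P y → P (x * y)) → (∀ x y, P x → P y → P (x + y)) → ∀ x, P x

variable {B : Type} [Ring B] [Algebra SS B] {e z : Fin (n-1) → B} (H : IsBH n e z)

include H in
theorem IsBH.central (i : Fin (n-1)) (x : B) : e i * x = x * e i := by
  refine H.ind (fun x => e i * x = x * e i) ?_ ?_ ?_ ?_ ?_ x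
  · intro r; exact (Algebra.commutes r _).symm
  · intro j; exact H.ecomm i j
  · intro j; exact H.ezcomm i j
  · intro x y hx hy; rw [← mul_assoc, hx, mul_assoc, hy, mul_assoc]
  · intro x y hx hy; rw [mul_add, add_mul, hx, hy]

/-- `e_i` as an element of the centre. -/
def cE (i : Fin (n-1)) : Subalgebra.center SS (B) :=
  ⟨e i, Subalgebra.mem_center_iff.2 fun b => (H.central i b).symm⟩

theorem cE_sq (i : Fin (n-1)) : cE H i * cE H i = cE H i := Subtype.ext (H.esq i)

/-- The primitive idempotent attached to `J`. -/
def cJ (J : Finset (Fin (n-1))) : Subalgebra.center SS (B) :=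
  (∏ i ∈ J, cE H i) * ∏ i ∈ Finset.univ \ J, (1 - cE H i)

theorem idem_a {R : Type} [CommRing R] {a p q : R} (h : a * a = a) :
    a * p * q * a = a * p * q := by
  linear_combination p * q * h

theorem idem_b {R : Type} [CommRing R] {a p q : R} (h : a * a = a) :
    p * ((1 - a) * q) * a = 0 := by
  linear_combination -p * q * h

theorem idem_c {R : Type} [CommRing R] {a : R} (h : a * a = a) :
    (1 - a) * (1 - a) = 1 - a := by
  linear_combination h

theorem cJ_mem {J : Finset (Fin (n-1))} {i : Fin (n-1)} (h : i ∈ J) : cJ H J * cE H i = cJ H J := by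
  unfold cJ
  rw [← Finset.mul_prod_erase J _ h]
  exact idem_a (cE_sq H i)

theorem cJ_not_mem {J : Finset (Fin (n-1))} {i : Fin (n-1)} (h : i ∉ J) : cJ H J * cE H i = 0 := by
  unfold cJ
  rw [← Finset.mul_prod_erase (Finset.univ \ J) _ (by simpa using h : i ∈ Finset.univ \ J)]
  exact idem_b (cE_sq H i)

theorem cJ_sq (J : Finset (Fin (n-1))) : cJ H J * cJ H J = cJ H J := by
  unfold cJ
  have h1 : (∏ i ∈ J, cE H i) * (∏ i ∈ J, cE H i) = ∏ i ∈ J, cE H i := by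
    rw [← Finset.prod_mul_distrib]
    exact Finset.prod_congr rfl fun i _ => cE_sq H i
  have h2 : (∏ i ∈ Finset.univ \ J, (1 - cE H i)) * (∏ i ∈ Finset.univ \ J, (1 - cE H i)) =
      ∏ i ∈ Finset.univ \ J, (1 - cE H i) := by
    rw [← Finset.prod_mul_distrib]
    exact Finset.prod_congr rfl fun i _ => idem_c (cE_sq H i)
  rw [mul_mul_mul_comm, h1, h2]

theorem cJ_sum : ∑ J : Finset (Fin (n-1)), cJ H J = 1 := by
  have := Finset.prod_add (fun i : Fin (n-1) => cE H i) (fun i => 1 - cE H i) Finset.univ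
  simp only [add_sub_cancel, Finset.prod_const_one, Finset.powerset_univ] at this
  exact this.symm

/-- Membership of a natural number in `J`. -/
def inJ (J : Finset (Fin (n-1))) (k : ℕ) : Prop := ∃ h : k < n - 1, (⟨k, h⟩ : Fin (n-1)) ∈ J

/-- The colouring attached to `J`. -/
def colJ (J : Finset (Fin (n-1))) (k : ℕ) : ℕ := Nat.count (fun i => ¬ inJ J i) k

theorem colJ_mono (J : Finset (Fin (n-1))) : Monotone (colJ J) := Nat.count_monotone _

theorem colJ_succ (J : Finset (Fin (n-1))) (k : ℕ) :
    colJ J k = colJ J (k+1) ↔ inJ J k := by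
  unfold colJ
  rw [Nat.count_succ]
  by_cases h : inJ J k <;> simp [h]

/-- Hecke generator with respect to a central idempotent. -/
def TE {B : Type} [Ring B] [Algebra SS B] (E x : B) : B := E * x + qq • (1 - E)

/-- The Hecke generators attached to `J`. -/
def TJ (J : Finset (Fin (n-1))) (k : ℕ) : B :=
  if h : k < n - 1 then TE (cJ H J).1 (z ⟨k, h⟩) else 0

theorem mix_mul {E : B} (hE : E * E = E) (hcen : ∀ x, E * x = x * E) (x y : B) (a b : SS) :
    (E * x + a • (1 - E)) * (E * y + b • (1 - E)) = E * (x * y) + (a * b) • (1 - E) := by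
  have h1 : E * x * (E * y) = E * (x * y) := by
    rw [hcen x, mul_assoc, ← mul_assoc E E, hE, ← mul_assoc, ← hcen x, mul_assoc]
  have h2 : E * x * (1 - E) = 0 := by
    rw [hcen x, mul_assoc, mul_sub, mul_one, hE, sub_self, mul_zero]
  have h3 : (1 - E) * (E * y) = 0 := by
    rw [← mul_assoc, sub_mul, one_mul, hE, sub_self, zero_mul]
  have h4 : (1 - E) * (1 - E) = 1 - E := by
    rw [mul_sub, sub_mul, sub_mul, hE]; simp
  rw [add_mul, mul_add, mul_add, h1, mul_smul_comm, h2, smul_mul_assoc, h3, smul_mul_smul_comm, h4]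
  simp

theorem qq_sq : qq * qq = 1 + (qq - qqi) * qq := by
  have : qqi * qq = 1 := by
    unfold qq qqi
    rw [← LaurentPolynomial.T_add]
    simp
  linear_combination this

theorem iota1_key (f : B →ₐ[SS] BT n)
    (hE : ∀ i : Fin (n - 1), f (e i) = btE i)
    (hZ : ∀ i : Fin (n - 1), f (z i) = btE i * btG i) (J : Finset (Fin (n-1)))
    (x : B) (hx : f x = 0) : (cJ H J).1 * x = 0 := by
  have hcen : ∀ y, (cJ H J).1 * y = y * (cJ H J).1 := fun y =>
    (Subalgebra.mem_center_iff.1 (cJ H J).2 y).symm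
  have hid : (cJ H J).1 * (cJ H J).1 = (cJ H J).1 := congrArg Subtype.val (cJ_sq H J)
  have hmem : ∀ i ∈ J, (cJ H J).1 * e i = (cJ H J).1 := fun i h =>
    congrArg Subtype.val (cJ_mem H h)
  have hnmem : ∀ i, i ∉ J → (cJ H J).1 * e i = 0 := fun i h =>
    congrArg Subtype.val (cJ_not_mem H h)
  have hT : ∀ (k) (h : k < n - 1), TJ H J k =
      (cJ H J).1 * z ⟨k, h⟩ + qq • (1 - (cJ H J).1) := fun k h => by simp [TJ, TE, h]
  obtain ⟨ρ, hρE, hρG⟩ := rho_exists (A := B) (colJ J) (TJ H J) (colJ_mono J)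
    (by
      intro k l hk hl hkl
      obtain ⟨hk, hk'⟩ := (colJ_succ J k).1 hk
      obtain ⟨hl, hl'⟩ := (colJ_succ J l).1 hl
      rw [hT k hk, hT l hl, mix_mul hid hcen, mix_mul hid hcen,
        H.zcomm _ _ (by unfold Nat.dist; simp only; omega)])
    (by
      intro k hk hl
      obtain ⟨hk, hk'⟩ := (colJ_succ J k).1 hk
      obtain ⟨hl, hl'⟩ := (colJ_succ J (k+1)).1 hl
      rw [hT k hk, hT (k+1) hl, mix_mul hid hcen, mix_mul hid hcen, mix_mul hid hcen,
        mix_mul hid hcen, H.braid _ _ (by unfold Nat.dist; simp only; omega)])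
    (by
      intro k hk
      obtain ⟨hk, hk'⟩ := (colJ_succ J k).1 hk
      rw [hT k hk, mix_mul hid hcen, H.quad, mul_add, hmem _ hk', qq_sq, mul_smul_comm,
        smul_add, smul_smul, add_smul, one_smul]
      abel)
    n
  let σ₀ : XX (colJ J) := ⟨1, fun a b h _ => h⟩
  have hσ : ∀ k, pv σ₀ k = k := fun k => rfl
  have main : ∀ y : B, ∀ φ : XX (colJ J) → B,
      (cJ H J).1 * (ρ (f y) φ σ₀) = (cJ H J).1 * (y * φ σ₀) := by
    refine H.ind (fun y => ∀ φ : XX (colJ J) → B,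
      (cJ H J).1 * (ρ (f y) φ σ₀) = (cJ H J).1 * (y * φ σ₀)) ?_ ?_ ?_ ?_ ?_
    · intro r
      intro φ
      rw [AlgHom.commutes, AlgHom.commutes, Module.algebraMap_end_apply, Pi.smul_apply,
        Algebra.smul_def]
    · intro i
      intro φ
      rw [hE, hρE, eOp_apply, hσ, hσ, ← mul_assoc]
      by_cases h : i ∈ J
      · rw [if_pos ((colJ_succ J i.1).2 ⟨i.2, h⟩), hmem i h]
      · rw [if_neg (fun hh => h ((colJ_succ J i.1).1 hh).2), hnmem i h, mul_zero, zero_mul]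
    · intro i
      intro φ
      rw [hZ, map_mul, hρE, hρG, Module.End.mul_apply, eOp_apply, gOp_apply, tt, hσ, hσ]
      by_cases h : i ∈ J
      · have h1 : colJ J i.1 = colJ J (i.1+1) := (colJ_succ J i.1).2 ⟨i.2, h⟩
        rw [if_pos h1, if_pos h1, step_same h1, hT i.1 i.2, ← mul_assoc, ← mul_assoc, mul_add,
          ← mul_assoc, hid, mul_smul_comm, mul_sub, mul_one, hid, sub_self, smul_zero, add_zero]
      · have h1 : ¬ colJ J i.1 = colJ J (i.1+1) := by
          rw [colJ_succ]; exact fun ⟨_, h'⟩ => h h'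
        rw [if_neg h1, ← H.ez, ← mul_assoc, ← mul_assoc, hnmem i h]
        simp
    · intro y w hy hz
      intro φ
      rw [map_mul, map_mul, Module.End.mul_apply, hy, ← mul_assoc, hcen y, mul_assoc, hz,
        ← mul_assoc, ← hcen y]
      simp only [mul_assoc]
    · intro y w hy hz
      intro φ
      rw [map_add, map_add, LinearMap.add_apply, Pi.add_apply, mul_add, hy, hz, add_mul, mul_add]
  have := main x (fun _ => 1)
  rw [hx] at this
  simpa using this.symm


include H in
theorem iota1_gen (f : B →ₐ[SS] BT n)
    (hE : ∀ i : Fin (n - 1), f (e i) = btE i)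
    (hZ : ∀ i : Fin (n - 1), f (z i) = btE i * btG i) (x : B) (hx : f x = 0) : x = 0 := by
  have h : ((∑ J : Finset (Fin (n-1)), cJ H J : Subalgebra.center SS B) : B) * x = 0 := by
    rw [AddSubmonoidClass.coe_finsetSum, Finset.sum_mul]
    exact Finset.sum_eq_zero fun J _ => iota1_key H f hE hZ J x hx
  rw [cJ_sum] at h
  simpa using h

end bh

end

/-- the `S`-algebra homomorphism `ι₁ : bH_n(q) → E_n(q)` determined by
`ι₁(e_i) = e_i` and `ι₁(z_i) = e_i g_i` is injective, i.e. `bH_n(q)` embeds into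
`E_n(q)`. -/
theorem iota1_injective (n : ℕ) (f : BH n →ₐ[SS] BT n)
    (hE : ∀ i : Fin (n - 1), f (bhE i) = btE i)
    (hZ : ∀ i : Fin (n - 1), f (bhZ i) = btE i * btG i) :
    Function.Injective f := by
  rw [injective_iff_map_eq_zero]
  intro x hx
  letI R : Ring (BH n) := Algebra.semiringToRing SS
  exact @iota1_gen n (BH n) R _ bhE bhZ
    ⟨bh_esq, bh_ecomm, bh_braid, bh_zcomm, bh_ez, bh_ezcomm, bh_quad,
      fun P h1 h2 h3 h4 h5 => bh_induction h1 h2 h3 h4 h5⟩ f hE hZ x hx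
end

section
/- The tied–boxed Temperley–Lieb algebra bTL_n(q) admits the following presentation: the unital associative S-algebra presented by generators E_1,…,E_{n−1}, D_1,…,D_{n−1} subject to the relations E_i² = E_i and E_i E_j = E_j E_i for all i,j; D_i² = (q+q⁻¹) D_i; D_i D_j D_i = E_j D_i E_j for |i−j| = 1; D_i D_j = D_j D_i for |i−j| > 1; D_i E_i = D_i; and D_i E_j = E_j D_i for all i,j, is isomorphic to bTL_n(q) via the map sending E_i to the image of e_i and D_i to the image of q⁻¹ e_i + z_i in bTL_n(q). -/
open scoped Classical

noncomputable section

/-- The Steinberg element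
`z_{i,j} = e_i e_j (1 + q z_i + q z_j + q² z_i z_j + q² z_j z_i + q³ z_i z_j z_i)`
of `bH_n(q)`. -/
def steinbergBH {n : ℕ} (i j : Fin (n - 1)) : BH n :=
  bhE i * bhE j *
    (1 + qq • bhZ i + qq • bhZ j + qq ^ 2 • (bhZ i * bhZ j) + qq ^ 2 • (bhZ j * bhZ i) +
      qq ^ 3 • (bhZ i * bhZ j * bhZ i))

/-- The relations defining `bTL_n(q)` as a quotient of `bH_n(q)`: the Steinberg
elements `z_{i,j}` with `|i−j| = 1` are set to `0`. -/
inductive BTLRel (n : ℕ) : BH n → BH n → Prop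
  | steinberg (i j : Fin (n - 1)) (h : Nat.dist i.1 j.1 = 1) : BTLRel n (steinbergBH i j) 0

/-- The tied–boxed Temperley–Lieb algebra `bTL_n(q)`: the quotient of `bH_n(q)` by the
two-sided ideal generated by the Steinberg elements. -/
abbrev BTL (n : ℕ) : Type := RingQuot (BTLRel n)

end

noncomputable section

/-- Generators `E_1,…,E_{n−1}, D_1,…,D_{n−1}` of the presented algebra of
Proposition: the presentation of `bTL_n(q)`. -/
inductive TLpGen (n : ℕ) : Type
  | e : Fin (n - 1) → TLpGen n
  | d : Fin (n - 1) → TLpGen n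

/-- The relations `E_i² = E_i`, `E_i E_j = E_j E_i`, `D_i² = (q+q⁻¹) D_i`,
`D_i D_j D_i = E_j D_i E_j` for `|i−j| = 1`, `D_i D_j = D_j D_i` for `|i−j| > 1`,
`D_i E_i = D_i`, `D_i E_j = E_j D_i`. -/
inductive TLpRel (n : ℕ) : FreeAlgebra SS (TLpGen n) → FreeAlgebra SS (TLpGen n) → Prop
  | esq (i : Fin (n - 1)) :
      TLpRel n (FreeAlgebra.ι SS (TLpGen.e i) * FreeAlgebra.ι SS (TLpGen.e i))
        (FreeAlgebra.ι SS (TLpGen.e i))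
  | ecomm (i j : Fin (n - 1)) :
      TLpRel n (FreeAlgebra.ι SS (TLpGen.e i) * FreeAlgebra.ι SS (TLpGen.e j))
        (FreeAlgebra.ι SS (TLpGen.e j) * FreeAlgebra.ι SS (TLpGen.e i))
  | dsq (i : Fin (n - 1)) :
      TLpRel n (FreeAlgebra.ι SS (TLpGen.d i) * FreeAlgebra.ι SS (TLpGen.d i))
        ((qq + qqi) • FreeAlgebra.ι SS (TLpGen.d i))
  | ddd (i j : Fin (n - 1)) (h : Nat.dist i.1 j.1 = 1) :
      TLpRel n
        (FreeAlgebra.ι SS (TLpGen.d i) * FreeAlgebra.ι SS (TLpGen.d j) *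
          FreeAlgebra.ι SS (TLpGen.d i))
        (FreeAlgebra.ι SS (TLpGen.e j) * FreeAlgebra.ι SS (TLpGen.d i) *
          FreeAlgebra.ι SS (TLpGen.e j))
  | dcomm (i j : Fin (n - 1)) (h : 1 < Nat.dist i.1 j.1) :
      TLpRel n (FreeAlgebra.ι SS (TLpGen.d i) * FreeAlgebra.ι SS (TLpGen.d j))
        (FreeAlgebra.ι SS (TLpGen.d j) * FreeAlgebra.ι SS (TLpGen.d i))
  | de (i : Fin (n - 1)) :
      TLpRel n (FreeAlgebra.ι SS (TLpGen.d i) * FreeAlgebra.ι SS (TLpGen.e i))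
        (FreeAlgebra.ι SS (TLpGen.d i))
  | decomm (i j : Fin (n - 1)) :
      TLpRel n (FreeAlgebra.ι SS (TLpGen.d i) * FreeAlgebra.ι SS (TLpGen.e j))
        (FreeAlgebra.ι SS (TLpGen.e j) * FreeAlgebra.ι SS (TLpGen.d i))

/-- The presented algebra with generators `E_i, D_i` and the relations above. -/
abbrev BTLpres (n : ℕ) : Type := RingQuot (TLpRel n)

/-- `D_i D_j D_i = E_j D_i E_j` from the Steinberg relation. -/
theorem aux_ddd {R A : Type*} [CommRing R] [Semiring A] [Algebra R A]
    (q p : R) (hqp : q * p = 1) (a b x y : A)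
    (ha : a * a = a) (hb : b * b = b) (hab : b * a = a * b)
    (hax : a * x = x) (hxa : x * a = x) (hby : b * y = y) (hyb : y * b = y)
    (hxb : x * b = b * x) (hya : y * a = a * y)
    (hx : x * x = a + (q - p) • x)
    (hst : a * b * (1 + q • x + q • y + q ^ 2 • (x * y) + q ^ 2 • (y * x) +
      q ^ 3 • (x * y * x)) = 0) :
    (p • a + x) * (p • b + y) * (p • a + x) = b * (p • a + x) * b := by
  have h1 : b * (x * y) = x * y := by rw [← mul_assoc, ← hxb, mul_assoc, hby]
  have h2 : a * (y * x) = y * x := by rw [← mul_assoc, ← hya, mul_assoc, hax]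
  have h3 : x * (a * y) = x * y := by rw [← mul_assoc, hxa]
  have h4 : a * (b * x) = b * x := by rw [← mul_assoc, ← hab, mul_assoc, hax]
  have h5 : a * (x * y) = x * y := by rw [← mul_assoc, hax]
  have h6 : b * (y * x) = y * x := by rw [← mul_assoc, hby]
  have h7 : x * (y * a) = x * y := by rw [hya, h3]
  have h8 : b * (x * (y * x)) = x * (y * x) := by
    rw [← mul_assoc x, ← mul_assoc b, h1]
  have h9 : a * (x * (y * x)) = x * (y * x) := by rw [← mul_assoc, hax]
  have h10 : x * (b * x) = a * b + (q - p) • (b * x) := by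
    rw [← mul_assoc, hxb, mul_assoc, hx, mul_add, hab, mul_smul_comm]
  have h11 : a * (b * a) = a * b := by rw [hab, ← mul_assoc, ha]
  have h12 : x * (b * a) = b * x := by rw [hab, ← mul_assoc, hxa, hxb]
  have h13 : a * (a * y) = a * y := by rw [← mul_assoc, ha]
  have h14 : b * (a * b) = a * b := by rw [← mul_assoc, hab, mul_assoc, hb]
  have h15 : b * (b * x) = b * x := by rw [← mul_assoc, hb]
  have h16 : a * (a * b) = a * b := by rw [← mul_assoc, ha]
  have hst' := congrArg (fun t => p ^ 3 • t) hst
  simp only [mul_add, add_mul, smul_mul_assoc, mul_smul_comm, smul_smul, smul_add, mul_assoc,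
    mul_one, h1, h2, h3, h4, h5, h6, h7, h8, h9, h10, h11, h12, h13, h14, h15, hax, hxa, hby,
    hya, hxb, ha, hb, hx, hab, h16, smul_zero] at hst' ⊢
  have e1 : p ^ 3 * q = p ^ 2 := by linear_combination p ^ 2 * hqp
  have e2 : p ^ 3 * q ^ 2 = p := by linear_combination (p ^ 2 * q + p) * hqp
  have e3 : p ^ 3 * q ^ 3 = 1 := by linear_combination (p ^ 2 * q ^ 2 + p * q + 1) * hqp
  simp only [e1, e2, e3, one_smul] at hst'
  have e4 : p * (q - p) = 1 - p ^ 2 := by linear_combination hqp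
  try simp only [e4, smul_add, smul_smul]
  rw [← add_zero (p • (a * b) + b * x), ← hst']
  match_scalars <;> ring1

/-- `D_i² = (q + q⁻¹) D_i`. -/
theorem aux_dsq {R A : Type*} [CommRing R] [Semiring A] [Algebra R A]
    (q p : R) (hqp : q * p = 1) (a x : A) (ha : a * a = a)
    (hax : a * x = x) (hxa : x * a = x) (hx : x * x = a + (q - p) • x) :
    (p • a + x) * (p • a + x) = (q + p) • (p • a + x) := by
  simp only [mul_add, add_mul, smul_mul_assoc, mul_smul_comm, ha, hax, hxa, hx]
  match_scalars <;> first | ring1 | linear_combination hqp |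
    linear_combination -hqp | linear_combination p * hqp | linear_combination -p * hqp

/-- `z_i² = e_i + (q - q⁻¹) z_i`. -/
theorem aux_quad {R A : Type*} [CommRing R] [Semiring A] [Algebra R A]
    (q p : R) (hqp : q * p = 1) (a d : A) (ha : a * a = a)
    (had : a * d = d) (hda : d * a = d) (hd : d * d = (q + p) • d) :
    (d + (-p) • a) * (d + (-p) • a) = a + (q - p) • (d + (-p) • a) := by
  simp only [mul_add, add_mul, smul_mul_assoc, mul_smul_comm, ha, had, hda, hd]
  match_scalars <;> first | ring1 | linear_combination hqp |
    linear_combination -hqp | linear_combination p * hqp | linear_combination -p * hqp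

/-- The triple product `z_i z_j z_i` in terms of `D`. -/
theorem aux_zzz {R A : Type*} [CommRing R] [Semiring A] [Algebra R A]
    (q p : R) (hqp : q * p = 1) (a b d f : A)
    (ha : a * a = a) (hab : b * a = a * b)
    (had : a * d = d) (hda : d * a = d) (hbf : b * f = f) 
    (hdb : d * b = b * d) (hfa : f * a = a * f)
    (hb : b * b = b) (hd : d * d = (q + p) • d)
    (hdd : d * f * d = b * d * b) :
    (d + (-p) • a) * (f + (-p) • b) * (d + (-p) • a) =
      p ^ 2 • (b * d) + p ^ 2 • (a * f) + (-p) • (d * f) + (-p) • (f * d) + (-p ^ 3) • (a * b) := by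
  have h1 : d * (a * f) = d * f := by rw [← mul_assoc, hda]
  have h2 : a * (f * d) = f * d := by rw [← mul_assoc, ← hfa, mul_assoc, had]
  have h3 : d * (b * d) = (q + p) • (b * d) := by
    rw [← mul_assoc, hdb, mul_assoc, hd, mul_smul_comm]
  have h4 : a * (b * d) = b * d := by rw [← mul_assoc, ← hab, mul_assoc, had]
  have h5 : d * (a * b) = b * d := by rw [← mul_assoc, hda, hdb]
  have h6 : a * (a * b) = a * b := by rw [← mul_assoc, ha]
  have h7 : a * (a * f) = a * f := by rw [← mul_assoc, ha]
  have h8 : d * (f * d) = b * d := by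
    rw [← mul_assoc, hdd, mul_assoc, hdb, ← mul_assoc, hb]
  simp only [mul_add, add_mul, smul_mul_assoc, mul_smul_comm, mul_assoc, hab, hfa, hdb,
    had, hda, ha, hd, hbf, h1, h2, h3, h4, h5, h6, h7, h8]
  match_scalars <;> first | ring1 | linear_combination hqp |
    linear_combination -hqp | linear_combination p * hqp | linear_combination -p * hqp

/-- The Steinberg relation from `D_i D_j D_i = E_j D_i E_j`. -/
theorem aux_st {R A : Type*} [CommRing R] [Semiring A] [Algebra R A]
    (q p : R) (hqp : q * p = 1) (a b d f : A)
    (ha : a * a = a) (hab : b * a = a * b)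
    (had : a * d = d) (hda : d * a = d) (hbf : b * f = f) (hfb : f * b = f)
    (hdb : d * b = b * d) (hfa : f * a = a * f)
    (hb : b * b = b) (hd : d * d = (q + p) • d)
    (hdd : d * f * d = b * d * b) :
    a * b * (1 + q • (d + (-p) • a) + q • (f + (-p) • b) + q ^ 2 • ((d + (-p) • a) * (f + (-p) • b)) +
      q ^ 2 • ((f + (-p) • b) * (d + (-p) • a)) +
      q ^ 3 • ((d + (-p) • a) * (f + (-p) • b) * (d + (-p) • a))) = 0 := by
  rw [aux_zzz q p hqp a b d f ha hab had hda hbf hdb hfa hb hd hdd]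
  have c1 : b * (d * f) = d * f := by rw [← mul_assoc, ← hdb, mul_assoc, hbf]
  have c2 : a * (d * f) = d * f := by rw [← mul_assoc, had]
  have c3 : b * (f * d) = f * d := by rw [← mul_assoc, hbf]
  have c4 : a * (f * d) = f * d := by rw [← mul_assoc, ← hfa, mul_assoc, had]
  have c5 : a * (b * d) = b * d := by rw [← mul_assoc, ← hab, mul_assoc, had]
  have c6 : b * (b * d) = b * d := by rw [← mul_assoc, hb]
  have c7 : b * (a * f) = a * f := by rw [← mul_assoc, hab, mul_assoc, hbf]
  have c8 : a * (a * f) = a * f := by rw [← mul_assoc, ha]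
  have c9 : b * (a * b) = a * b := by rw [← mul_assoc, hab, mul_assoc, hb]
  have c10 : a * (a * b) = a * b := by rw [← mul_assoc, ha]
  have c11 : d * (a * b) = b * d := by rw [← mul_assoc, hda, hdb]
  simp only [mul_add, add_mul, smul_mul_assoc, mul_smul_comm, mul_assoc, mul_one,
    hab, hfa, hdb, hfb, hb, hbf,
    c1, c2, c3, c4, c5, c6, c7, c8, c9, c10, c11]
  have e3 : q ^ 3 * p ^ 3 = 1 := by rw [← mul_pow, hqp, one_pow]
  have e2 : q ^ 2 * p ^ 2 = 1 := by rw [← mul_pow, hqp, one_pow]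
  match_scalars
  · linear_combination -2 * hqp + 2 * e2 - e3
  · linear_combination -2 * q * hqp + q * e2
  · linear_combination -2 * q * hqp + q * e2
  · linear_combination -q ^ 2 * hqp
  · linear_combination -q ^ 2 * hqp

theorem qq_mul_qqi : qq * qqi = 1 := by
  rw [qq, qqi, ← LaurentPolynomial.T_add]; simp

/-! ### Relations in `bTL_n(q)` -/

def btlE {n : ℕ} (i : Fin (n - 1)) : BTL n := RingQuot.mkAlgHom SS (BTLRel n) (bhE i)

def btlZ {n : ℕ} (i : Fin (n - 1)) : BTL n := RingQuot.mkAlgHom SS (BTLRel n) (bhZ i)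

theorem bh_rel {n : ℕ} {u v : FreeAlgebra SS (BHGen n)} (h : BHRel n u v) :
    RingQuot.mkAlgHom SS (BTLRel n) (RingQuot.mkAlgHom SS (BHRel n) u) =
      RingQuot.mkAlgHom SS (BTLRel n) (RingQuot.mkAlgHom SS (BHRel n) v) :=
  congrArg _ (RingQuot.mkAlgHom_rel SS h)

theorem btl_esq {n : ℕ} (i : Fin (n - 1)) : btlE i * btlE i = btlE i := by
  simpa only [btlE, btlZ, bhE, bhZ, map_mul] using bh_rel (BHRel.esq i)

theorem btl_ecomm {n : ℕ} (i j : Fin (n - 1)) : btlE i * btlE j = btlE j * btlE i := by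
  simpa only [btlE, btlZ, bhE, bhZ, map_mul] using bh_rel (BHRel.ecomm i j)

theorem btl_zcomm {n : ℕ} (i j : Fin (n - 1)) (h : 1 < Nat.dist i.1 j.1) :
    btlZ i * btlZ j = btlZ j * btlZ i := by
  simpa only [btlE, btlZ, bhE, bhZ, map_mul] using bh_rel (BHRel.zcomm i j h)

theorem btl_ez {n : ℕ} (i : Fin (n - 1)) : btlE i * btlZ i = btlZ i := by
  simpa only [btlE, btlZ, bhE, bhZ, map_mul] using bh_rel (BHRel.ez i)

theorem btl_ezcomm {n : ℕ} (i j : Fin (n - 1)) : btlE i * btlZ j = btlZ j * btlE i := by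
  simpa only [btlE, btlZ, bhE, bhZ, map_mul] using bh_rel (BHRel.ezcomm i j)

theorem btl_ze {n : ℕ} (i : Fin (n - 1)) : btlZ i * btlE i = btlZ i := by
  rw [← btl_ezcomm, btl_ez]

theorem btl_quad {n : ℕ} (i : Fin (n - 1)) :
    btlZ i * btlZ i = btlE i + (qq - qqi) • btlZ i := by
  simpa only [btlE, btlZ, bhE, bhZ, map_mul, map_add, map_smul] using bh_rel (BHRel.quad i)

theorem btl_steinberg {n : ℕ} (i j : Fin (n - 1)) (h : Nat.dist i.1 j.1 = 1) :
    btlE i * btlE j * (1 + qq • btlZ i + qq • btlZ j + qq ^ 2 • (btlZ i * btlZ j) +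
      qq ^ 2 • (btlZ j * btlZ i) + qq ^ 3 • (btlZ i * btlZ j * btlZ i)) = 0 := by
  simpa only [btlE, btlZ, steinbergBH, map_mul, map_add, map_smul, map_one, map_zero] using
    RingQuot.mkAlgHom_rel SS (BTLRel.steinberg i j h)

/-- The map on generators from the presented algebra to `bTL_n(q)`. -/
def fwdGen (n : ℕ) : TLpGen n → BTL n
  | .e i => btlE i
  | .d i => qqi • btlE i + btlZ i

theorem fwd_rel (n : ℕ) ⦃u v : FreeAlgebra SS (TLpGen n)⦄ (h : TLpRel n u v) :
    FreeAlgebra.lift SS (fwdGen n) u = FreeAlgebra.lift SS (fwdGen n) v := by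
  cases h with
  | esq i => simpa [fwdGen] using btl_esq i
  | ecomm i j => simpa [fwdGen] using btl_ecomm i j
  | dsq i =>
    simp only [map_mul, map_smul, FreeAlgebra.lift_ι_apply, fwdGen]
    exact aux_dsq qq qqi qq_mul_qqi _ _ (btl_esq i) (btl_ez i) (btl_ze i) (btl_quad i)
  | ddd i j h =>
    simp only [map_mul, FreeAlgebra.lift_ι_apply, fwdGen]
    exact aux_ddd qq qqi qq_mul_qqi _ _ _ _ (btl_esq i) (btl_esq j) (btl_ecomm j i)
      (btl_ez i) (btl_ze i) (btl_ez j) (btl_ze j) (btl_ezcomm j i).symm (btl_ezcomm i j).symm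
      (btl_quad i) (btl_steinberg i j h)
  | dcomm i j h =>
    simp only [map_mul, FreeAlgebra.lift_ι_apply, fwdGen, mul_add, add_mul, smul_mul_assoc,
      mul_smul_comm, btl_ecomm i j, btl_zcomm i j h, btl_ezcomm]
    match_scalars <;> ring1
  | de i =>
    simp only [map_mul, FreeAlgebra.lift_ι_apply, fwdGen, add_mul, smul_mul_assoc, btl_esq,
      btl_ze]
  | decomm i j =>
    simp only [map_mul, FreeAlgebra.lift_ι_apply, fwdGen, mul_add, add_mul, smul_mul_assoc,
      mul_smul_comm, btl_ecomm i j, btl_ezcomm]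

/-- The homomorphism from the presented algebra to `bTL_n(q)`. -/
def fwd (n : ℕ) : BTLpres n →ₐ[SS] BTL n :=
  RingQuot.liftAlgHom SS ⟨FreeAlgebra.lift SS (fwdGen n), fwd_rel n⟩

/-! ### Relations in the presented algebra -/

def prE {n : ℕ} (i : Fin (n - 1)) : BTLpres n :=
  RingQuot.mkAlgHom SS (TLpRel n) (FreeAlgebra.ι SS (TLpGen.e i))

def prD {n : ℕ} (i : Fin (n - 1)) : BTLpres n :=
  RingQuot.mkAlgHom SS (TLpRel n) (FreeAlgebra.ι SS (TLpGen.d i))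

theorem pr_esq {n : ℕ} (i : Fin (n - 1)) : prE i * prE i = prE i := by
  simpa only [prE, prD, map_mul] using RingQuot.mkAlgHom_rel SS (TLpRel.esq i)

theorem pr_ecomm {n : ℕ} (i j : Fin (n - 1)) : prE i * prE j = prE j * prE i := by
  simpa only [prE, prD, map_mul] using RingQuot.mkAlgHom_rel SS (TLpRel.ecomm i j)

theorem pr_dsq {n : ℕ} (i : Fin (n - 1)) : prD i * prD i = (qq + qqi) • prD i := by
  simpa only [prE, prD, map_mul, map_smul] using RingQuot.mkAlgHom_rel SS (TLpRel.dsq i)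

theorem pr_ddd {n : ℕ} (i j : Fin (n - 1)) (h : Nat.dist i.1 j.1 = 1) :
    prD i * prD j * prD i = prE j * prD i * prE j := by
  simpa only [prE, prD, map_mul] using RingQuot.mkAlgHom_rel SS (TLpRel.ddd i j h)

theorem pr_dcomm {n : ℕ} (i j : Fin (n - 1)) (h : 1 < Nat.dist i.1 j.1) :
    prD i * prD j = prD j * prD i := by
  simpa only [prE, prD, map_mul] using RingQuot.mkAlgHom_rel SS (TLpRel.dcomm i j h)

theorem pr_de {n : ℕ} (i : Fin (n - 1)) : prD i * prE i = prD i := by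
  simpa only [prE, prD, map_mul] using RingQuot.mkAlgHom_rel SS (TLpRel.de i)

theorem pr_decomm {n : ℕ} (i j : Fin (n - 1)) : prD i * prE j = prE j * prD i := by
  simpa only [prE, prD, map_mul] using RingQuot.mkAlgHom_rel SS (TLpRel.decomm i j)

theorem pr_ed {n : ℕ} (i : Fin (n - 1)) : prE i * prD i = prD i := by
  rw [← pr_decomm, pr_de]

/-- The map on generators from `bH_n(q)` to the presented algebra. -/
def bwdGen (n : ℕ) : BHGen n → BTLpres n
  | .e i => prE i
  | .z i => prD i + (-qqi) • prE i

theorem bwd_rel (n : ℕ) ⦃u v : FreeAlgebra SS (BHGen n)⦄ (h : BHRel n u v) :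
    FreeAlgebra.lift SS (bwdGen n) u = FreeAlgebra.lift SS (bwdGen n) v := by
  cases h with
  | esq i => simpa [bwdGen] using pr_esq i
  | ecomm i j => simpa [bwdGen] using pr_ecomm i j
  | braid i j h =>
    simp only [map_mul, FreeAlgebra.lift_ι_apply, bwdGen]
    have h' : Nat.dist j.1 i.1 = 1 := by rw [Nat.dist_comm]; exact h
    rw [aux_zzz qq qqi qq_mul_qqi _ _ _ _ (pr_esq i) (pr_ecomm j i) (pr_ed i) (pr_de i)
        (pr_ed j) (pr_decomm i j) (pr_decomm j i) (pr_esq j) (pr_dsq i) (pr_ddd i j h),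
      aux_zzz qq qqi qq_mul_qqi _ _ _ _ (pr_esq j) (pr_ecomm i j) (pr_ed j) (pr_de j)
        (pr_ed i) (pr_decomm j i) (pr_decomm i j) (pr_esq i) (pr_dsq j) (pr_ddd j i h'),
      pr_ecomm j i]
    match_scalars <;> ring1
  | zcomm i j h =>
    simp only [map_mul, FreeAlgebra.lift_ι_apply, bwdGen, mul_add, add_mul, smul_mul_assoc,
      mul_smul_comm, pr_ecomm i j, pr_dcomm i j h, pr_decomm]
    match_scalars <;> ring1
  | ez i =>
    simp only [map_mul, FreeAlgebra.lift_ι_apply, bwdGen, mul_add, mul_smul_comm, pr_esq,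
      pr_ed]
  | ezcomm i j =>
    simp only [map_mul, FreeAlgebra.lift_ι_apply, bwdGen, mul_add, add_mul, smul_mul_assoc,
      mul_smul_comm, pr_ecomm i j, pr_decomm]
  | quad i =>
    simp only [map_mul, map_add, map_smul, FreeAlgebra.lift_ι_apply, bwdGen]
    exact aux_quad qq qqi qq_mul_qqi _ _ (pr_esq i) (pr_ed i) (pr_de i) (pr_dsq i)

/-- The homomorphism from `bH_n(q)` to the presented algebra. -/
def bwdH (n : ℕ) : BH n →ₐ[SS] BTLpres n :=
  RingQuot.liftAlgHom SS ⟨FreeAlgebra.lift SS (bwdGen n), bwd_rel n⟩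

theorem bwdH_e {n : ℕ} (i : Fin (n - 1)) : bwdH n (bhE i) = prE i := by
  rw [bwdH, bhE, RingQuot.liftAlgHom_mkAlgHom_apply, FreeAlgebra.lift_ι_apply]; rfl

theorem bwdH_z {n : ℕ} (i : Fin (n - 1)) : bwdH n (bhZ i) = prD i + (-qqi) • prE i := by
  rw [bwdH, bhZ, RingQuot.liftAlgHom_mkAlgHom_apply, FreeAlgebra.lift_ι_apply]; rfl

theorem bwdH_rel (n : ℕ) ⦃u v : BH n⦄ (h : BTLRel n u v) : bwdH n u = bwdH n v := by
  cases h with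
  | steinberg i j h =>
    simp only [steinbergBH, map_mul, map_add, map_smul, map_one, map_zero, bwdH_e, bwdH_z]
    exact aux_st qq qqi qq_mul_qqi _ _ _ _ (pr_esq i) (pr_ecomm j i) (pr_ed i) (pr_de i)
        (pr_ed j) (pr_de j) (pr_decomm i j) (pr_decomm j i) (pr_esq j) (pr_dsq i)
        (pr_ddd i j h)

/-- The homomorphism from `bTL_n(q)` to the presented algebra. -/
def bwd (n : ℕ) : BTL n →ₐ[SS] BTLpres n :=
  RingQuot.liftAlgHom SS ⟨bwdH n, bwdH_rel n⟩

theorem fwd_e {n : ℕ} (i : Fin (n - 1)) : fwd n (prE i) = btlE i := by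
  rw [fwd, prE, RingQuot.liftAlgHom_mkAlgHom_apply, FreeAlgebra.lift_ι_apply]; rfl

theorem fwd_d {n : ℕ} (i : Fin (n - 1)) : fwd n (prD i) = qqi • btlE i + btlZ i := by
  rw [fwd, prD, RingQuot.liftAlgHom_mkAlgHom_apply, FreeAlgebra.lift_ι_apply]; rfl

theorem bwd_e {n : ℕ} (i : Fin (n - 1)) : bwd n (btlE i) = prE i := by
  rw [bwd, btlE, RingQuot.liftAlgHom_mkAlgHom_apply, bwdH_e]

theorem bwd_z {n : ℕ} (i : Fin (n - 1)) : bwd n (btlZ i) = prD i + (-qqi) • prE i := by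
  rw [bwd, btlZ, RingQuot.liftAlgHom_mkAlgHom_apply, bwdH_z]

theorem fwd_comp_bwd (n : ℕ) : (fwd n).comp (bwd n) = AlgHom.id SS (BTL n) := by
  apply RingQuot.ringQuot_ext'
  apply RingQuot.ringQuot_ext'
  apply FreeAlgebra.hom_ext
  funext g
  cases g with
  | e i =>
    change fwd n (bwd n (btlE i)) = btlE i
    rw [bwd_e, fwd_e]
  | z i =>
    change fwd n (bwd n (btlZ i)) = btlZ i
    rw [bwd_z, map_add, map_smul, fwd_e, fwd_d, add_assoc]
    match_scalars <;> ring1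

theorem bwd_comp_fwd (n : ℕ) : (bwd n).comp (fwd n) = AlgHom.id SS (BTLpres n) := by
  apply RingQuot.ringQuot_ext'
  apply FreeAlgebra.hom_ext
  funext g
  cases g with
  | e i =>
    change bwd n (fwd n (prE i)) = prE i
    rw [fwd_e, bwd_e]
  | d i =>
    change bwd n (fwd n (prD i)) = prD i
    rw [fwd_d, map_add, map_smul, bwd_e, bwd_z]
    match_scalars <;> ring1

/-- the presented algebra above is isomorphic to the tied–boxed
Temperley–Lieb algebra `bTL_n(q)` via `E_i ↦ e_i` and `D_i ↦ q⁻¹ e_i + z_i`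
(images taken in the quotient `bTL_n(q)` of `bH_n(q)`). -/
theorem bTL_presentation (n : ℕ) :
    ∃ f : BTLpres n ≃ₐ[SS] BTL n,
      (∀ i : Fin (n - 1),
        f (RingQuot.mkAlgHom SS (TLpRel n) (FreeAlgebra.ι SS (TLpGen.e i)))
          = RingQuot.mkAlgHom SS (BTLRel n) (bhE i)) ∧
      (∀ i : Fin (n - 1),
        f (RingQuot.mkAlgHom SS (TLpRel n) (FreeAlgebra.ι SS (TLpGen.d i)))
          = RingQuot.mkAlgHom SS (BTLRel n) (qqi • bhE i + bhZ i)) := by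
  refine ⟨AlgEquiv.ofAlgHom (fwd n) (bwd n) (fwd_comp_bwd n) (bwd_comp_fwd n), ?_, ?_⟩
  · intro i
    exact fwd_e i
  · intro i
    rw [map_add, map_smul]
    exact fwd_d i

end
end

section
/- There exists an injective S-algebra homomorphism ι₂ : bTL_n(q) → PTL_n(q) such that ι₂ ∘ π₂ = π₁ ∘ ι₁, where π₂ : bH_n(q) → bTL_n(q) and π₁ : E_n(q) → PTL_n(q) are the canonical quotient projections and ι₁ : bH_n(q) → E_n(q) is the embedding determined by ι₁(e_i) = e_i and ι₁(z_i) = e_i g_i. -/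
open scoped Classical

noncomputable section

/-- The element `e_i e_j g_{i,j}` of `E_n(q)`, where
`g_{i,j} = 1 + q g_i + q g_j + q² g_i g_j + q² g_j g_i + q³ g_i g_j g_i`. -/
def steinbergBT {n : ℕ} (i j : Fin (n - 1)) : BT n :=
  btE i * btE j *
    (1 + qq • btG i + qq • btG j + qq ^ 2 • (btG i * btG j) + qq ^ 2 • (btG j * btG i) +
      qq ^ 3 • (btG i * btG j * btG i))

/-- The relations defining the partition Temperley–Lieb algebra as a quotient of
`E_n(q)`: the elements `e_i e_j g_{i,j}` with `|i−j| = 1` are set to `0`. -/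
inductive PTLRel (n : ℕ) : BT n → BT n → Prop
  | steinberg (i j : Fin (n - 1)) (h : Nat.dist i.1 j.1 = 1) : PTLRel n (steinbergBT i j) 0

/-- The partition Temperley–Lieb algebra `PTL_n(q)`: the quotient of `E_n(q)` by the
two-sided ideal generated by the elements `e_i e_j g_{i,j}`. -/
abbrev PTL (n : ℕ) : Type := RingQuot (PTLRel n)

end

set_option linter.unusedSimpArgs false

noncomputable section

namespace TiedBoxed

/-- Block index of a label, where `T k` says that `k` and `k+1` lie in one block. -/
def blk (T : ℕ → Prop) : ℕ → ℕ
  | 0 => 0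
  | k + 1 => if T k then blk T k else blk T k + 1

lemma blk_succ_eq (T : ℕ → Prop) (k : ℕ) : blk T k = blk T (k + 1) ↔ T k := by
  by_cases h : T k <;> simp [blk, h]

lemma blk_mono (T : ℕ → Prop) : Monotone (blk T) := by
  apply monotone_nat_of_le_succ
  intro k
  by_cases h : T k <;> simp [blk, h]

/-- Arrangements of the labels in which the labels of each block appear in increasing order. -/
structure Arr (T : ℕ → Prop) where
  p : Equiv.Perm ℕ
  inc : ∀ x y, x < y → blk T (p x) = blk T (p y) → p x < p y

variable {T : ℕ → Prop}

lemma Arr.ext' {s t : Arr T} (h : ∀ k, s.p k = t.p k) : s = t := by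
  cases s; cases t
  congr
  exact Equiv.ext h

/-- Positions `i`, `i+1` carry labels of the same block. -/
def Arr.same (s : Arr T) (i : ℕ) : Prop := blk T (s.p i) = blk T (s.p (i + 1))

lemma Arr.same_next (s : Arr T) {i : ℕ} (h : s.same i) : s.p (i + 1) = s.p i + 1 := by
  have h1 := s.inc i (i + 1) (by omega) h
  by_contra hne
  obtain ⟨r, hr⟩ := s.p.surjective (s.p i + 1)
  have hb1 : blk T (s.p i) ≤ blk T (s.p r) := blk_mono T (by omega)
  have hb2 : blk T (s.p r) ≤ blk T (s.p (i + 1)) := blk_mono T (by omega)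
  unfold Arr.same at h
  have hi : r ≠ i := by rintro rfl; omega
  have hi' : r ≠ i + 1 := by rintro rfl; omega
  rcases Nat.lt_or_gt_of_ne hi with h2 | h2
  · have := s.inc r i h2 (by omega)
    omega
  · have := s.inc (i + 1) r (by omega) (by omega)
    omega

lemma Arr.same_T (s : Arr T) {i : ℕ} (h : s.same i) : T (s.p i) := by
  rw [← blk_succ_eq T, ← s.same_next h]
  exact h

/-- Swap the labels at positions `i`, `i+1` if they lie in distinct blocks. -/
def Arr.sw (s : Arr T) (i : ℕ) : Arr T :=
  if h : s.same i then s else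
  { p := (Equiv.swap i (i + 1)).trans s.p
    inc := by
      intro x y hxy hb
      have key : Equiv.swap i (i + 1) x < Equiv.swap i (i + 1) y := by
        unfold Arr.same at h
        simp only [Equiv.trans_apply, Equiv.swap_apply_def] at hb ⊢
        grind
      exact s.inc _ _ key hb }

lemma Arr.sw_p (s : Arr T) {i : ℕ} (h : ¬ s.same i) (k : ℕ) :
    (s.sw i).p k = if k = i then s.p (i + 1) else if k = i + 1 then s.p i else s.p k := by
  simp only [Arr.sw, h, dite_false, Equiv.trans_apply, Equiv.swap_apply_def]
  grind

variable {R N : Type*} [CommRing R] [AddCommMonoid N] [Module R N]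

/-- The tie operator. -/
def opE (R : Type*) [CommRing R] [Module R N] (i : ℕ) : Module.End R (Arr T → N) where
  toFun f := fun s => if s.same i then f s else 0
  map_add' f g := by ext s; by_cases h : s.same i <;> simp [h]
  map_smul' c f := by ext s; by_cases h : s.same i <;> simp [h]

/-- The braid operator. -/
def opG (Z : ℕ → Module.End R N) (i : ℕ) : Module.End R (Arr T → N) where
  toFun f := fun s => if s.same i then Z (s.p i) (f s) else f (s.sw i)
  map_add' f g := by ext s; by_cases h : s.same i <;> simp [h]
  map_smul' c f := by ext s; by_cases h : s.same i <;> simp [h]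

lemma opE_apply (i : ℕ) (f : Arr T → N) (s : Arr T) :
    opE R i f s = if s.same i then f s else 0 := rfl

lemma opG_apply (Z : ℕ → Module.End R N) (i : ℕ) (f : Arr T → N) (s : Arr T) :
    opG Z i f s = if s.same i then Z (s.p i) (f s) else f (s.sw i) := rfl

/-- The relations on the label operators. -/
structure Good (T : ℕ → Prop) (q qi : R) (Z : ℕ → Module.End R N) : Prop where
  quad : ∀ a, T a → ∀ v, Z a (Z a v) = v + (q - qi) • Z a v
  braid : ∀ a, T a → T (a + 1) → ∀ v, Z a (Z (a + 1) (Z a v)) = Z (a + 1) (Z a (Z (a + 1) v))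
  comm : ∀ a c, T a → T c → a + 1 < c → ∀ v, Z a (Z c v) = Z c (Z a v)
  st : ∀ a, T a → T (a + 1) → ∀ v, v + q • Z a v + q • Z (a + 1) v + q ^ 2 • Z a (Z (a + 1) v)
    + q ^ 2 • Z (a + 1) (Z a v) + q ^ 3 • Z a (Z (a + 1) (Z a v)) = 0

lemma same_sw_self (s : Arr T) (i : ℕ) : (s.sw i).same i ↔ s.same i := by
  by_cases h : s.same i
  · simp [Arr.sw, h]
  · simp only [Arr.same, Arr.sw_p s h] at *
    grind

lemma sw_sw (s : Arr T) (i : ℕ) : (s.sw i).sw i = s := by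
  by_cases h : s.same i
  · simp [Arr.sw, h]
  · have h' : ¬ (s.sw i).same i := by rwa [same_sw_self]
    apply Arr.ext'
    intro k
    rw [Arr.sw_p _ h', Arr.sw_p _ h, Arr.sw_p _ h, Arr.sw_p _ h]
    grind

section far

lemma far_p (s : Arr T) (i j : ℕ) (h : i + 1 < j ∨ j + 1 < i) :
    (s.sw i).p j = s.p j ∧ (s.sw i).p (j + 1) = s.p (j + 1) := by
  by_cases hs : s.same i
  · simp [Arr.sw, hs]
  · rw [Arr.sw_p s hs, Arr.sw_p s hs]
    grind

lemma far_same (s : Arr T) (i j : ℕ) (h : i + 1 < j ∨ j + 1 < i) :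
    (s.sw i).same j ↔ s.same j := by
  obtain ⟨h1, h2⟩ := far_p s i j h
  simp [Arr.same, h1, h2]

lemma far_sw (s : Arr T) (i j : ℕ) (h : i + 1 < j ∨ j + 1 < i) :
    (s.sw i).sw j = (s.sw j).sw i := by
  by_cases hi : s.same i
  · have : (s.sw j).same i := (far_same s j i h.symm).2 hi
    simp [Arr.sw, hi]
    grind [Arr.sw]
  by_cases hj : s.same j
  · have : (s.sw i).same j := (far_same s i j h).2 hj
    simp [Arr.sw, hj]
    grind [Arr.sw]
  have hi' : ¬ (s.sw j).same i := by rwa [far_same s j i h.symm]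
  have hj' : ¬ (s.sw i).same j := by rwa [far_same s i j h]
  apply Arr.ext'
  intro k
  simp only [Arr.sw_p _ hi', Arr.sw_p _ hj', Arr.sw_p _ hi, Arr.sw_p _ hj]
  grind

end far

lemma op_esq (i : ℕ) : opE R i * opE R i = (opE R i : Module.End R (Arr T → N)) := by
  apply LinearMap.ext; intro f; funext s
  simp only [Module.End.mul_apply, opE_apply]
  split_ifs <;> rfl

lemma op_ecomm (i j : ℕ) : opE R i * opE R j = (opE R j * opE R i : Module.End R (Arr T → N)) := by
  apply LinearMap.ext; intro f; funext s
  simp only [Module.End.mul_apply, opE_apply]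
  split_ifs <;> rfl

variable {q qi : R} {Z : ℕ → Module.End R N}

lemma op_ge (i : ℕ) : opG Z i * opE R i = (opE R i * opG Z i : Module.End R (Arr T → N)) := by
  apply LinearMap.ext; intro f; funext s
  simp only [Module.End.mul_apply, opE_apply, opG_apply, same_sw_self]
  split_ifs <;> rfl

lemma op_quad (hg : Good T q qi Z) (i : ℕ) :
    opG Z i * opG Z i = (1 + (q - qi) • (opE R i * opG Z i) : Module.End R (Arr T → N)) := by
  apply LinearMap.ext; intro f; funext s
  simp only [Module.End.mul_apply, opE_apply, opG_apply, same_sw_self, LinearMap.add_apply,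
    LinearMap.smul_apply, Pi.add_apply, Pi.smul_apply, Module.End.one_apply, sw_sw]
  split_ifs with h
  · exact hg.quad _ (s.same_T h) _
  · simp

lemma op_gecomm (i j : ℕ) (h : i + 1 < j ∨ j + 1 < i) :
    opG Z i * opE R j = (opE R j * opG Z i : Module.End R (Arr T → N)) := by
  apply LinearMap.ext; intro f; funext s
  simp only [Module.End.mul_apply, opE_apply, opG_apply, far_same s i j h]
  split_ifs <;> simp

lemma op_gcomm (hg : Good T q qi Z) (i j : ℕ) (h : i + 1 < j ∨ j + 1 < i) :
    opG Z i * opG Z j = (opG Z j * opG Z i : Module.End R (Arr T → N)) := by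
  apply LinearMap.ext; intro f; funext s
  simp only [Module.End.mul_apply, opG_apply, far_same s i j h, far_same s j i h.symm,
    far_sw s i j h, (far_p s i j h).1, (far_p s j i h.symm).1]
  split_ifs with h1 h2 h2
  · have a1 := s.same_next h1
    have a2 := s.same_next h2
    have n1 : s.p i ≠ s.p j := fun h => by have := s.p.injective h; omega
    have n2 : s.p (i + 1) ≠ s.p j := fun h => by have := s.p.injective h; omega
    have n3 : s.p i ≠ s.p (j + 1) := fun h => by have := s.p.injective h; omega
    rcases Nat.lt_or_gt_of_ne n1 with h3 | h3
    · exact hg.comm _ _ (s.same_T h1) (s.same_T h2) (by omega) _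
    · exact (hg.comm _ _ (s.same_T h2) (s.same_T h1) (by omega) _).symm
  all_goals rfl

/-! Relations for adjacent indices. -/

lemma same_iff (s : Arr T) (i : ℕ) : s.same i ↔ blk T (s.p i) = blk T (s.p (i + 1)) := Iff.rfl

lemma l0 (s : Arr T) (i : ℕ) (h : ¬ blk T (s.p i) = blk T (s.p (i + 1))) :
    (s.sw i).p i = s.p (i + 1) := by
  rw [Arr.sw_p s h]; simp

lemma l1 (s : Arr T) (i : ℕ) (h : ¬ blk T (s.p i) = blk T (s.p (i + 1))) :
    (s.sw i).p (i + 1) = s.p i := by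
  rw [Arr.sw_p s h]; simp

lemma l2 (s : Arr T) (i : ℕ) (h : ¬ blk T (s.p i) = blk T (s.p (i + 1))) :
    (s.sw i).p (i + 2) = s.p (i + 2) := by
  rw [Arr.sw_p s h]; simp

lemma r0 (s : Arr T) (i : ℕ) (h : ¬ blk T (s.p (i + 1)) = blk T (s.p (i + 2))) :
    (s.sw (i + 1)).p i = s.p i := by
  rw [Arr.sw_p s h]; grind

lemma r1 (s : Arr T) (i : ℕ) (h : ¬ blk T (s.p (i + 1)) = blk T (s.p (i + 2))) :
    (s.sw (i + 1)).p (i + 1) = s.p (i + 2) := by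
  rw [Arr.sw_p s h]; simp

lemma r2 (s : Arr T) (i : ℕ) (h : ¬ blk T (s.p (i + 1)) = blk T (s.p (i + 2))) :
    (s.sw (i + 1)).p (i + 2) = s.p (i + 1) := by
  rw [Arr.sw_p s h]; simp

lemma two (i : ℕ) : i + 1 + 1 = i + 2 := rfl

lemma sw_braid (s : Arr T) (i : ℕ) (h1 : ¬ blk T (s.p i) = blk T (s.p (i + 1)))
    (h2 : ¬ blk T (s.p (i + 1)) = blk T (s.p (i + 2)))
    (h3 : ¬ blk T (s.p i) = blk T (s.p (i + 2))) :
    ((s.sw i).sw (i + 1)).sw i = ((s.sw (i + 1)).sw i).sw (i + 1) := by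
  have a1 : ¬ s.same i := h1
  have a2 : ¬ (s.sw i).same (i + 1) := by
    simp only [same_iff, two, l1, l2, h1, h3, not_false_eq_true]
  have a3 : ¬ ((s.sw i).sw (i + 1)).same i := by
    simp only [same_iff, two, l0, l1, l2, r0, r1, r2, h1, h2, h3, not_false_eq_true]
  have b1 : ¬ s.same (i + 1) := h2
  have b2 : ¬ (s.sw (i + 1)).same i := by
    simp only [same_iff, r0, r1, h2, h3, not_false_eq_true]
  have b3 : ¬ ((s.sw (i + 1)).sw i).same (i + 1) := by
    simp only [same_iff, two, l0, l1, l2, r0, r1, r2, h1, h2, h3, not_false_eq_true]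
  apply Arr.ext'
  intro k
  simp only [Arr.sw_p _ a3, Arr.sw_p _ a2, Arr.sw_p _ a1, Arr.sw_p _ b3, Arr.sw_p _ b2,
    Arr.sw_p _ b1]
  grind

lemma op_braid (hg : Good T q qi Z) (i : ℕ) :
    opG Z i * opG Z (i + 1) * opG Z i =
      (opG Z (i + 1) * opG Z i * opG Z (i + 1) : Module.End R (Arr T → N)) := by
  apply LinearMap.ext; intro f; funext s
  simp only [Module.End.mul_apply, opG_apply]
  by_cases h1 : blk T (s.p i) = blk T (s.p (i + 1)) <;>
    by_cases h2 : blk T (s.p (i + 1)) = blk T (s.p (i + 2))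
  · have h1' : s.same i := h1
    have h2' : s.same (i + 1) := h2
    simp only [h1', h2', if_true, s.same_next h1']
    apply hg.braid _ (s.same_T h1')
    rw [← s.same_next h1']
    exact s.same_T h2'
  · have h3 : ¬ blk T (s.p i) = blk T (s.p (i + 2)) := by rwa [h1]
    simp only [same_iff, two, l0, l1, l2, r0, r1, r2, h1, h2, h3, not_false_eq_true, if_true,
      if_false]
  · have h3 : ¬ blk T (s.p i) = blk T (s.p (i + 2)) := by rwa [← h2]
    have h4 : ¬ blk T (s.p i) = blk T (s.p (i + 1)) := h1
    simp only [same_iff, two, l0, l1, l2, r0, r1, r2, h4, h2, h3, not_false_eq_true, if_true,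
      if_false]
  · by_cases h3 : blk T (s.p i) = blk T (s.p (i + 2))
    · have h2' : ¬ blk T (s.p (i + 2)) = blk T (s.p (i + 1)) := fun h => h2 (Eq.symm h)
      simp only [same_iff, two, l0, l1, l2, r0, r1, r2, h1, h2, h2', h3, not_false_eq_true, if_true,
        if_false, sw_sw]
    · simp only [same_iff, two, l0, l1, l2, r0, r1, r2, h1, h2, h3, not_false_eq_true, if_true,
        if_false, sw_braid]

lemma three_cases (a b c : ℕ) : (a = b ∧ b = c) ∨ (a = b ∧ ¬ b = c ∧ ¬ c = b) ∨
    (b = c ∧ ¬ a = c ∧ ¬ c = a) ∨ (a = c ∧ ¬ c = b ∧ ¬ b = c) ∨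
    (¬ a = b ∧ ¬ b = a ∧ ¬ b = c ∧ ¬ c = b ∧ ¬ a = c ∧ ¬ c = a) := by
  omega

lemma op_egg (i : ℕ) : opE R i * opG Z (i + 1) * opG Z i =
    (opG Z (i + 1) * opG Z i * opE R (i + 1) : Module.End R (Arr T → N)) := by
  apply LinearMap.ext; intro f; funext s
  simp only [Module.End.mul_apply, opG_apply, opE_apply]
  rcases three_cases (blk T (s.p i)) (blk T (s.p (i + 1))) (blk T (s.p (i + 2))) with
    ⟨h1, h2⟩ | ⟨h1, h2, h3⟩ | ⟨h1, h2, h3⟩ | ⟨h1, h2, h3⟩ | ⟨h1, h2, h3, h4, h5, h6⟩ <;>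
    simp only [same_iff, two, l0, l1, l2, r0, r1, r2, *,
      not_false_eq_true, if_true, if_false, map_zero, ite_self]

lemma op_eeg (i : ℕ) : opE R i * opE R (i + 1) * opG Z (i + 1) =
    (opE R i * opG Z (i + 1) * opE R i : Module.End R (Arr T → N)) := by
  apply LinearMap.ext; intro f; funext s
  simp only [Module.End.mul_apply, opG_apply, opE_apply]
  rcases three_cases (blk T (s.p i)) (blk T (s.p (i + 1))) (blk T (s.p (i + 2))) with
    ⟨h1, h2⟩ | ⟨h1, h2, h3⟩ | ⟨h1, h2, h3⟩ | ⟨h1, h2, h3⟩ | ⟨h1, h2, h3, h4, h5, h6⟩ <;>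
    simp only [same_iff, two, l0, l1, l2, r0, r1, r2, *,
      not_false_eq_true, if_true, if_false, map_zero, ite_self]

lemma op_ege (i : ℕ) : opE R i * opG Z (i + 1) * opE R i =
    (opG Z (i + 1) * opE R i * opE R (i + 1) : Module.End R (Arr T → N)) := by
  apply LinearMap.ext; intro f; funext s
  simp only [Module.End.mul_apply, opG_apply, opE_apply]
  rcases three_cases (blk T (s.p i)) (blk T (s.p (i + 1))) (blk T (s.p (i + 2))) with
    ⟨h1, h2⟩ | ⟨h1, h2, h3⟩ | ⟨h1, h2, h3⟩ | ⟨h1, h2, h3⟩ | ⟨h1, h2, h3, h4, h5, h6⟩ <;>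
    simp only [same_iff, two, l0, l1, l2, r0, r1, r2, *,
      not_false_eq_true, if_true, if_false, map_zero, ite_self]

lemma op_egg' (i : ℕ) : opE R (i + 1) * opG Z i * opG Z (i + 1) =
    (opG Z i * opG Z (i + 1) * opE R i : Module.End R (Arr T → N)) := by
  apply LinearMap.ext; intro f; funext s
  simp only [Module.End.mul_apply, opG_apply, opE_apply]
  rcases three_cases (blk T (s.p i)) (blk T (s.p (i + 1))) (blk T (s.p (i + 2))) with
    ⟨h1, h2⟩ | ⟨h1, h2, h3⟩ | ⟨h1, h2, h3⟩ | ⟨h1, h2, h3⟩ | ⟨h1, h2, h3, h4, h5, h6⟩ <;>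
    simp only [same_iff, two, l0, l1, l2, r0, r1, r2, *,
      not_false_eq_true, if_true, if_false, map_zero, ite_self]

lemma op_eeg' (i : ℕ) : opE R (i + 1) * opE R i * opG Z i =
    (opE R (i + 1) * opG Z i * opE R (i + 1) : Module.End R (Arr T → N)) := by
  apply LinearMap.ext; intro f; funext s
  simp only [Module.End.mul_apply, opG_apply, opE_apply]
  rcases three_cases (blk T (s.p i)) (blk T (s.p (i + 1))) (blk T (s.p (i + 2))) with
    ⟨h1, h2⟩ | ⟨h1, h2, h3⟩ | ⟨h1, h2, h3⟩ | ⟨h1, h2, h3⟩ | ⟨h1, h2, h3, h4, h5, h6⟩ <;>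
    simp only [same_iff, two, l0, l1, l2, r0, r1, r2, *,
      not_false_eq_true, if_true, if_false, map_zero, ite_self]

lemma op_ege' (i : ℕ) : opE R (i + 1) * opG Z i * opE R (i + 1) =
    (opG Z i * opE R (i + 1) * opE R i : Module.End R (Arr T → N)) := by
  apply LinearMap.ext; intro f; funext s
  simp only [Module.End.mul_apply, opG_apply, opE_apply]
  rcases three_cases (blk T (s.p i)) (blk T (s.p (i + 1))) (blk T (s.p (i + 2))) with
    ⟨h1, h2⟩ | ⟨h1, h2, h3⟩ | ⟨h1, h2, h3⟩ | ⟨h1, h2, h3⟩ | ⟨h1, h2, h3, h4, h5, h6⟩ <;>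
    simp only [same_iff, two, l0, l1, l2, r0, r1, r2, *,
      not_false_eq_true, if_true, if_false, map_zero, ite_self]

lemma op_st (hg : Good T q qi Z) (i : ℕ) :
    opE R i * opE R (i + 1) * (1 + q • opG Z i + q • opG Z (i + 1)
      + q ^ 2 • (opG Z i * opG Z (i + 1)) + q ^ 2 • (opG Z (i + 1) * opG Z i)
      + q ^ 3 • (opG Z i * opG Z (i + 1) * opG Z i)) = (0 : Module.End R (Arr T → N)) := by
  apply LinearMap.ext; intro f; funext s
  simp only [Module.End.mul_apply, opG_apply, opE_apply, LinearMap.add_apply, Pi.add_apply,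
    LinearMap.smul_apply, Pi.smul_apply, Module.End.one_apply, LinearMap.zero_apply, Pi.zero_apply]
  by_cases h1 : s.same i
  · by_cases h2 : s.same (i + 1)
    · simp only [h1, h2, if_true, s.same_next h1]
      apply hg.st _ (s.same_T h1)
      rw [← s.same_next h1]
      exact s.same_T h2
    · simp [h2]
  · simp [h1]

lemma op_st' (hg : Good T q qi Z) (i : ℕ) :
    opE R (i + 1) * opE R i * (1 + q • opG Z (i + 1) + q • opG Z i
      + q ^ 2 • (opG Z (i + 1) * opG Z i) + q ^ 2 • (opG Z i * opG Z (i + 1))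
      + q ^ 3 • (opG Z (i + 1) * opG Z i * opG Z (i + 1))) = (0 : Module.End R (Arr T → N)) := by
  rw [← op_st hg i, op_braid hg, op_ecomm (i + 1) i]
  congr 1
  abel

lemma dist_one {i j : ℕ} (h : Nat.dist i j = 1) : j = i + 1 ∨ i = j + 1 := by
  unfold Nat.dist at h; omega

lemma dist_far {i j : ℕ} (h : 1 < Nat.dist i j) : i + 1 < j ∨ j + 1 < i := by
  unfold Nat.dist at h; omega

section rep

variable {M : Type} [AddCommMonoid M] [Module SS M] {W : ℕ → Module.End SS M}

/-- The action of the generators. -/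
def genMap (T : ℕ → Prop) (W : ℕ → Module.End SS M) (n : ℕ) :
    BTGen n → Module.End SS (Arr T → M)
  | BTGen.e i => opE SS i.1
  | BTGen.g i => opG W i.1

lemma rel_ok (hg : Good T qq qqi W) (n : ℕ) ⦃x y : FreeAlgebra SS (BTGen n)⦄ (h : BTRel n x y) :
    FreeAlgebra.lift SS (genMap T W n) x = FreeAlgebra.lift SS (genMap T W n) y := by
  cases h with
  | esq i => simpa [genMap] using op_esq _
  | ecomm i j => simpa [genMap] using op_ecomm _ _
  | braid i j h =>
    simp only [map_mul, FreeAlgebra.lift_ι_apply, genMap]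
    rcases dist_one h with h | h <;> rw [h]
    · exact op_braid hg _
    · exact (op_braid hg _).symm
  | gcomm i j h => simpa [genMap] using op_gcomm hg _ _ (dist_far h)
  | ge i => simpa [genMap] using op_ge _
  | gecomm i j h => simpa [genMap] using op_gecomm _ _ (dist_far h)
  | egg i j h =>
    simp only [map_mul, FreeAlgebra.lift_ι_apply, genMap]
    rcases dist_one h with h | h <;> rw [h]
    · exact op_egg _
    · exact op_egg' _
  | eeg i j h =>
    simp only [map_mul, FreeAlgebra.lift_ι_apply, genMap]
    rcases dist_one h with h | h <;> rw [h]
    · exact op_eeg _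
    · exact op_eeg' _
  | ege i j h =>
    simp only [map_mul, FreeAlgebra.lift_ι_apply, genMap]
    rcases dist_one h with h | h <;> rw [h]
    · exact op_ege _
    · exact op_ege' _
  | quad i =>
    simp only [map_mul, map_add, map_smul, map_one, FreeAlgebra.lift_ι_apply, genMap]
    exact op_quad hg _

/-- The representation of `E_n(q)`. -/
def repBT (hg : Good T qq qqi W) (n : ℕ) : BT n →ₐ[SS] Module.End SS (Arr T → M) :=
  RingQuot.liftAlgHom SS ⟨FreeAlgebra.lift SS (genMap T W n), rel_ok hg n⟩

lemma repBT_e (hg : Good T qq qqi W) (n : ℕ) (i : Fin (n - 1)) :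
    repBT hg n (btE i) = opE SS i.1 := by
  simp [repBT, btE, genMap]

lemma repBT_g (hg : Good T qq qqi W) (n : ℕ) (i : Fin (n - 1)) :
    repBT hg n (btG i) = opG W i.1 := by
  simp [repBT, btG, genMap]

lemma rel_ok2 (hg : Good T qq qqi W) (n : ℕ) ⦃x y : BT n⦄ (h : PTLRel n x y) :
    repBT hg n x = repBT hg n y := by
  cases h with
  | steinberg i j h =>
    simp only [steinbergBT, map_mul, map_add, map_smul, map_one, map_zero, repBT_e, repBT_g]
    rcases dist_one h with h | h <;> rw [h]
    · exact op_st hg _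
    · exact op_st' hg _

/-- The representation of `PTL_n(q)`. -/
def repPTL (hg : Good T qq qqi W) (n : ℕ) : PTL n →ₐ[SS] Module.End SS (Arr T → M) :=
  RingQuot.liftAlgHom SS ⟨repBT hg n, rel_ok2 hg n⟩

lemma repPTL_mk (hg : Good T qq qqi W) (n : ℕ) (x : BT n) :
    repPTL hg n (RingQuot.mkAlgHom SS (PTLRel n) x) = repBT hg n x := by
  simp [repPTL]

end rep

/-! Relations in `bTL_n(q)`. -/

section btl

variable {n : ℕ}

instance ringBTL : Ring (BTL n) := Algebra.semiringToRing SS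

instance ringPTL : Ring (PTL n) := Algebra.semiringToRing SS

/-- The image of `e_i` in `bTL_n(q)`. -/
def tE (i : Fin (n - 1)) : BTL n := RingQuot.mkAlgHom SS (BTLRel n) (bhE i)

/-- The image of `z_i` in `bTL_n(q)`. -/
def tZ (i : Fin (n - 1)) : BTL n := RingQuot.mkAlgHom SS (BTLRel n) (bhZ i)

lemma t_esq (i : Fin (n - 1)) : tE i * tE i = tE i := by
  simp only [tE, bhE, ← map_mul]
  rw [RingQuot.mkAlgHom_rel SS (BHRel.esq i)]

lemma t_ecomm (i j : Fin (n - 1)) : tE i * tE j = tE j * tE i := by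
  simp only [tE, bhE, ← map_mul]
  rw [RingQuot.mkAlgHom_rel SS (BHRel.ecomm i j)]

lemma t_braid (i j : Fin (n - 1)) (h : Nat.dist i.1 j.1 = 1) :
    tZ i * tZ j * tZ i = tZ j * tZ i * tZ j := by
  simp only [tZ, bhZ, ← map_mul]
  rw [RingQuot.mkAlgHom_rel SS (BHRel.braid i j h)]

lemma t_zcomm (i j : Fin (n - 1)) (h : 1 < Nat.dist i.1 j.1) : tZ i * tZ j = tZ j * tZ i := by
  simp only [tZ, bhZ, ← map_mul]
  rw [RingQuot.mkAlgHom_rel SS (BHRel.zcomm i j h)]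

lemma t_ez (i : Fin (n - 1)) : tE i * tZ i = tZ i := by
  simp only [tE, tZ, bhE, bhZ, ← map_mul]
  rw [RingQuot.mkAlgHom_rel SS (BHRel.ez i)]

lemma t_ezcomm (i j : Fin (n - 1)) : tE i * tZ j = tZ j * tE i := by
  simp only [tE, tZ, bhE, bhZ, ← map_mul]
  rw [RingQuot.mkAlgHom_rel SS (BHRel.ezcomm i j)]

lemma t_quad (i : Fin (n - 1)) : tZ i * tZ i = tE i + (qq - qqi) • tZ i := by
  simp only [tE, tZ, bhE, bhZ, ← map_mul, ← map_smul, ← map_add]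
  rw [RingQuot.mkAlgHom_rel SS (BHRel.quad i)]

lemma t_st (i j : Fin (n - 1)) (h : Nat.dist i.1 j.1 = 1) :
    tE i * tE j * (1 + qq • tZ i + qq • tZ j + qq ^ 2 • (tZ i * tZ j) + qq ^ 2 • (tZ j * tZ i) +
      qq ^ 3 • (tZ i * tZ j * tZ i)) = 0 := by
  have := RingQuot.mkAlgHom_rel SS (BTLRel.steinberg i j h)
  simp only [steinbergBH, map_mul, map_add, map_smul, map_one, map_zero] at this
  exact this

/-- The part of `bTL_n(q)` on which the `e_i` act by the pattern `I`. -/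
def part (I : Fin (n - 1) → Prop) : Submodule SS (BTL n) where
  carrier := {y | ∀ i, (I i → tE i * y = y) ∧ (¬ I i → tE i * y = 0)}
  zero_mem' := by intro i; simp
  add_mem' := by
    intro a b ha hb i
    refine ⟨fun h => ?_, fun h => ?_⟩
    · rw [mul_add, (ha i).1 h, (hb i).1 h]
    · rw [mul_add, (ha i).2 h, (hb i).2 h, add_zero]
  smul_mem' := by
    intro c a ha i
    refine ⟨fun h => ?_, fun h => ?_⟩
    · rw [mul_smul_comm, (ha i).1 h]
    · rw [mul_smul_comm, (ha i).2 h, smul_zero]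

lemma part_e {I : Fin (n - 1) → Prop} (y : part I) (i : Fin (n - 1)) (h : I i) :
    tE i * (y : BTL n) = y := (y.2 i).1 h

lemma part_e' {I : Fin (n - 1) → Prop} (y : part I) (i : Fin (n - 1)) (h : ¬ I i) :
    tE i * (y : BTL n) = 0 := (y.2 i).2 h

/-- Left multiplication by `z_a` on the part. -/
def zOp (I : Fin (n - 1) → Prop) (a : ℕ) : Module.End SS (part I) :=
  if h : a < n - 1 then
    (LinearMap.mulLeft SS (tZ ⟨a, h⟩)).restrict (by
      intro y hy i
      simp only [LinearMap.mulLeft_apply]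
      rw [← mul_assoc, t_ezcomm, mul_assoc]
      refine ⟨fun h => ?_, fun h => ?_⟩
      · rw [(hy i).1 h]
      · rw [(hy i).2 h, mul_zero])
  else 0

lemma zOp_coe (I : Fin (n - 1) → Prop) (a : ℕ) (h : a < n - 1) (y : part I) :
    ((zOp I a y : part I) : BTL n) = tZ ⟨a, h⟩ * y := by
  simp only [zOp, h, dite_true]
  rfl

/-- The tie pattern as a predicate on naturals. -/
def pat (I : Fin (n - 1) → Prop) (k : ℕ) : Prop := ∃ h : k < n - 1, I ⟨k, h⟩

lemma zOp_good (I : Fin (n - 1) → Prop) : Good (pat I) qq qqi (zOp I) where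
  quad := by
    rintro a ⟨h, hI⟩ v
    apply Subtype.ext
    simp only [zOp_coe I _ h, Submodule.coe_add, Submodule.coe_smul]
    rw [← mul_assoc, t_quad, add_mul, part_e v _ hI, smul_mul_assoc]
  braid := by
    rintro a ⟨h, hI⟩ ⟨h', hI'⟩ v
    apply Subtype.ext
    simp only [zOp_coe I _ h, zOp_coe I _ h']
    simp only [← mul_assoc]
    rw [t_braid _ _ (by simp [Nat.dist])]
  comm := by
    rintro a c ⟨h, hI⟩ ⟨h', hI'⟩ hac v
    apply Subtype.ext
    simp only [zOp_coe I _ h, zOp_coe I _ h']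
    simp only [← mul_assoc]
    rw [t_zcomm _ _ (by simp only [Nat.dist]; omega)]
  st := by
    rintro a ⟨h, hI⟩ ⟨h', hI'⟩ v
    apply Subtype.ext
    have key := congrArg (fun x => x * (v : BTL n))
      (t_st (⟨a, h⟩ : Fin (n - 1)) ⟨a + 1, h'⟩ (by simp [Nat.dist]))
    have hc : ∀ w : part I, tE ⟨a, h⟩ * tE ⟨a + 1, h'⟩ * (w : BTL n) = w := by
      intro w
      rw [mul_assoc, part_e w _ hI', part_e w _ hI]
    simp only [zero_mul] at key
    rw [mul_assoc] at key
    have := hc (v + qq • zOp I a v + qq • zOp I (a + 1) v + qq ^ 2 • zOp I a (zOp I (a + 1) v)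
      + qq ^ 2 • zOp I (a + 1) (zOp I a v) + qq ^ 3 • zOp I a (zOp I (a + 1) (zOp I a v)))
    rw [← this]
    simp only [zOp_coe I _ h, zOp_coe I _ h', Submodule.coe_add, Submodule.coe_smul,
      Submodule.coe_zero]
    rw [← key]
    simp only [add_mul, one_mul, smul_mul_assoc, mul_assoc]

/-- Every nonzero element stays nonzero after cutting down by a suitable tie pattern. -/
lemma exists_cut (x : BTL n) (hx : x ≠ 0) (s : Finset (Fin (n - 1))) :
    ∃ u : BTL n, x * u ≠ 0 ∧ ∀ i ∈ s, tE i * u = u ∨ tE i * u = 0 := by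
  induction s using Finset.induction_on with
  | empty => exact ⟨1, by simpa using hx, by simp⟩
  | insert i s _ ih =>
    obtain ⟨u, hu, hs⟩ := ih
    have hc : ∀ j, tE j * (tE i * u) = tE i * (tE j * u) := by
      intro j
      rw [← mul_assoc, t_ecomm, mul_assoc]
    have hii : tE i * (tE i * u) = tE i * u := by rw [← mul_assoc, t_esq]
    by_cases h : x * (tE i * u) = 0
    · refine ⟨u - tE i * u, by rwa [mul_sub, h, sub_zero], ?_⟩
      intro j hj
      rcases Finset.mem_insert.1 hj with rfl | hj
      · right; rw [mul_sub, hii, sub_self]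
      · rw [mul_sub, hc]
        rcases hs j hj with h' | h' <;> rw [h'] <;> simp
    · refine ⟨tE i * u, h, ?_⟩
      intro j hj
      rcases Finset.mem_insert.1 hj with rfl | hj
      · left; exact hii
      · rw [hc]
        rcases hs j hj with h' | h' <;> rw [h'] <;> simp

/-- The identity arrangement. -/
def idArr (T : ℕ → Prop) : Arr T := ⟨1, fun _ _ h _ => h⟩

lemma idArr_same (T : ℕ → Prop) (i : ℕ) : (idArr T).same i ↔ T i := blk_succ_eq T i

lemma bt_comm (i j : Fin (n - 1)) (h : Nat.dist i.1 j.1 = 1) :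
    btE i * btE j * btG j = btG j * (btE i * btE j) := by
  have h1 := RingQuot.mkAlgHom_rel SS (BTRel.eeg i j h)
  have h2 := RingQuot.mkAlgHom_rel SS (BTRel.ege i j h)
  simp only [map_mul] at h1 h2
  simp only [btE, btG]
  rw [h1, h2, mul_assoc]

lemma bt_esq (i : Fin (n - 1)) : btE i * btE i = btE i := by
  simp only [btE, ← map_mul]
  rw [RingQuot.mkAlgHom_rel SS (BTRel.esq i)]

lemma bt_ecomm (i j : Fin (n - 1)) : btE i * btE j = btE j * btE i := by
  simp only [btE, ← map_mul]
  rw [RingQuot.mkAlgHom_rel SS (BTRel.ecomm i j)]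

lemma iota_st (ι₁ : BH n →ₐ[SS] BT n)
    (hE : ∀ i : Fin (n - 1), ι₁ (bhE i) = btE i)
    (hZ : ∀ i : Fin (n - 1), ι₁ (bhZ i) = btE i * btG i)
    (i j : Fin (n - 1)) (h : Nat.dist i.1 j.1 = 1) :
    ι₁ (steinbergBH i j) = steinbergBT i j := by
  simp only [steinbergBH, steinbergBT, map_mul, map_add, map_smul, map_one, hE, hZ]
  have cj := bt_comm i j h
  have ci : btE i * btE j * btG i = btG i * (btE i * btE j) := by
    rw [bt_ecomm i j]
    exact bt_comm j i (by rwa [Nat.dist_comm])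
  have ei : btE i * btE j * btE i = btE i * btE j := by
    rw [bt_ecomm i j, mul_assoc, bt_esq]
  have ej : btE i * btE j * btE j = btE i * btE j := by
    rw [mul_assoc, bt_esq]
  generalize btE i * btE j = c at *
  have hi : ∀ w, c * (btE i * btG i * w) = btG i * (c * w) := by
    intro w; rw [← mul_assoc, ← mul_assoc, ei, ci, mul_assoc]
  have hj : ∀ w, c * (btE j * btG j * w) = btG j * (c * w) := by
    intro w; rw [← mul_assoc, ← mul_assoc, ej, cj, mul_assoc]
  have hi' : ∀ w, c * (btG i * w) = btG i * (c * w) := by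
    intro w; rw [← mul_assoc, ci, mul_assoc]
  have hj' : ∀ w, c * (btG j * w) = btG j * (c * w) := by
    intro w; rw [← mul_assoc, cj, mul_assoc]
  have hi1 : c * (btE i * btG i) = c * btG i := by rw [← mul_assoc, ei]
  have hj1 : c * (btE j * btG j) = c * btG j := by rw [← mul_assoc, ej]
  simp only [mul_add, mul_smul_comm, mul_assoc (btE i * btG i), mul_assoc (btE j * btG j),
    mul_assoc (btG i), mul_assoc (btG j), hi, hj, hi', hj', hi1, hj1]

end btl

end TiedBoxed

end

/-- there is an injective `S`-algebra homomorphism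
`ι₂ : bTL_n(q) → PTL_n(q)` with `ι₂ ∘ π₂ = π₁ ∘ ι₁`, where `π₂ : bH_n(q) → bTL_n(q)`
and `π₁ : E_n(q) → PTL_n(q)` are the canonical projections and `ι₁ : bH_n(q) → E_n(q)`
is the embedding determined by `ι₁(e_i) = e_i`, `ι₁(z_i) = e_i g_i`. -/
theorem exists_iota2 (n : ℕ) (ι₁ : BH n →ₐ[SS] BT n)
    (hE : ∀ i : Fin (n - 1), ι₁ (bhE i) = btE i)
    (hZ : ∀ i : Fin (n - 1), ι₁ (bhZ i) = btE i * btG i) :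
    ∃ ι₂ : BTL n →ₐ[SS] PTL n,
      Function.Injective ι₂ ∧
      ∀ x : BH n,
        ι₂ (RingQuot.mkAlgHom SS (BTLRel n) x)
          = RingQuot.mkAlgHom SS (PTLRel n) (ι₁ x) := by
  have hrel : ∀ ⦃x y : BH n⦄, BTLRel n x y →
      ((RingQuot.mkAlgHom SS (PTLRel n)).comp ι₁) x
        = ((RingQuot.mkAlgHom SS (PTLRel n)).comp ι₁) y := by
    intro x y h
    cases h with
    | steinberg i j h =>
      simp only [AlgHom.comp_apply, TiedBoxed.iota_st ι₁ hE hZ i j h, map_zero]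
      rw [RingQuot.mkAlgHom_rel SS (PTLRel.steinberg i j h), map_zero]
  have hmk : ∀ x : BH n, RingQuot.liftAlgHom SS
      ⟨(RingQuot.mkAlgHom SS (PTLRel n)).comp ι₁, hrel⟩ (RingQuot.mkAlgHom SS (BTLRel n) x)
      = RingQuot.mkAlgHom SS (PTLRel n) (ι₁ x) := by
    intro x
    simp
  refine ⟨RingQuot.liftAlgHom SS ⟨(RingQuot.mkAlgHom SS (PTLRel n)).comp ι₁, hrel⟩, ?_, hmk⟩
  rw [injective_iff_map_eq_zero]
  intro x hx
  by_contra hne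
  obtain ⟨u, hu, hcut⟩ := TiedBoxed.exists_cut x hne Finset.univ
  set I : Fin (n - 1) → Prop := fun i => TiedBoxed.tE i * u = u with hI
  have hmem : u ∈ TiedBoxed.part I := by
    intro i
    exact ⟨fun h => h, fun h => (hcut i (Finset.mem_univ i)).resolve_left h⟩
  have hg := TiedBoxed.zOp_good I
  have key : ∀ w : FreeAlgebra SS (BHGen n), ∀ f : TiedBoxed.Arr (TiedBoxed.pat I) →
      TiedBoxed.part I,
      ((TiedBoxed.repBT hg n (ι₁ (RingQuot.mkAlgHom SS (BHRel n) w)) f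
        (TiedBoxed.idArr _) : TiedBoxed.part I) : BTL n)
      = RingQuot.mkAlgHom SS (BTLRel n) (RingQuot.mkAlgHom SS (BHRel n) w)
        * (f (TiedBoxed.idArr _) : BTL n) := by
    intro w
    induction w using FreeAlgebra.induction with
    | grade0 r =>
      intro f
      simp only [AlgHom.commutes, Module.algebraMap_end_apply, Pi.smul_apply, Submodule.coe_smul,
        Algebra.smul_def]
    | grade1 g =>
      intro f
      cases g with
      | e i =>
        change ((TiedBoxed.repBT hg n (ι₁ (bhE i)) f _ : TiedBoxed.part I) : BTL n)
          = TiedBoxed.tE i * _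
        rw [hE, TiedBoxed.repBT_e, TiedBoxed.opE_apply, TiedBoxed.idArr_same]
        by_cases h : I i
        · have hp : TiedBoxed.pat I i.1 := ⟨i.2, h⟩
          rw [if_pos hp, TiedBoxed.part_e _ _ h]
        · have hp : ¬ TiedBoxed.pat I i.1 := fun ⟨_, h'⟩ => h h'
          rw [if_neg hp, TiedBoxed.part_e' _ _ h, Submodule.coe_zero]
      | z i =>
        change ((TiedBoxed.repBT hg n (ι₁ (bhZ i)) f _ : TiedBoxed.part I) : BTL n)
          = TiedBoxed.tZ i * _
        rw [hZ, map_mul, TiedBoxed.repBT_e, TiedBoxed.repBT_g, Module.End.mul_apply,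
          TiedBoxed.opE_apply, TiedBoxed.opG_apply, TiedBoxed.idArr_same]
        by_cases h : I i
        · have hp : TiedBoxed.pat I i.1 := ⟨i.2, h⟩
          rw [if_pos hp, if_pos hp]
          exact TiedBoxed.zOp_coe I i.1 i.2 _
        · have hp : ¬ TiedBoxed.pat I i.1 := fun ⟨_, h'⟩ => h h'
          rw [if_neg hp, ← TiedBoxed.t_ez, TiedBoxed.t_ezcomm, mul_assoc,
            TiedBoxed.part_e' _ _ h, mul_zero, Submodule.coe_zero]
    | mul a b ha hb =>
      intro f
      rw [map_mul, map_mul, map_mul, Module.End.mul_apply, ha, hb, map_mul, mul_assoc]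
    | add a b ha hb =>
      intro f
      simp only [map_add, LinearMap.add_apply, Pi.add_apply, Submodule.coe_add, ha, hb, add_mul]
  obtain ⟨y, rfl⟩ := RingQuot.mkAlgHom_surjective SS (BTLRel n) x
  obtain ⟨w, rfl⟩ := RingQuot.mkAlgHom_surjective SS (BHRel n) y
  rw [hmk] at hx
  have h0 := key w (fun _ => ⟨u, hmem⟩)
  rw [← TiedBoxed.repPTL_mk, hx, map_zero] at h0
  exact hu h0.symm
end
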